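/- arXiv:1409.5465 — 9 statements merged into one kernel-verified Lean document; each statement's English description precedes it below -/
import Mathlib

section
/- Let q be a nonzero complex number, V a nonzero finite-dimensional complex vector space, and T a linear endomorphism of V with T ≠ id_V satisfying (T − id)∘(T + q·id) = 0. If the induced endomorphism T ⊗ T of V ⊗ V also satisfies (T⊗T − id)∘(T⊗T + q·id) = 0, then q = 1. -/
open TensorProduct

/-- Let `q` be a nonzero complex number, `V` a nonzero finite-dimensional
complex vector space, and `T` a linear endomorphism of `V` with `T ≠ id` satisfying
`(T - id) ∘ (T + q • id) = 0`. If the induced endomorphism `T ⊗ T` of `V ⊗ V` also satisfies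
`(T⊗T - id) ∘ (T⊗T + q • id) = 0`, then `q = 1`. -/
theorem full_support_hecke_param_integral
    (q : ℂ) (hq : q ≠ 0)
    (V : Type) [AddCommGroup V] [Module ℂ V] [FiniteDimensional ℂ V] [Nontrivial V]
    (T : V →ₗ[ℂ] V) (hT : T ≠ LinearMap.id)
    (hrel : (T - LinearMap.id) ∘ₗ (T + q • LinearMap.id) = 0)
    (hrel2 : (TensorProduct.map T T - LinearMap.id) ∘ₗ
      (TensorProduct.map T T + q • LinearMap.id) = 0) :
    q = 1 := by
  obtain ⟨v, hv⟩ : ∃ v, T v ≠ v := by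
    by_contra! h
    exact hT (LinearMap.ext h)
  obtain ⟨w, hw⟩ : ∃ w, w = T v - v := ⟨_, rfl⟩
  have hw0 : w ≠ 0 := hw ▸ sub_ne_zero.mpr hv
  have hTv : T v = v + w := by rw [hw]; abel
  have hTw : T w = (-q) • w := by
    have h := LinearMap.congr_fun hrel v
    simp only [LinearMap.comp_apply, LinearMap.sub_apply, LinearMap.add_apply,
      LinearMap.smul_apply, LinearMap.id_apply, LinearMap.zero_apply, map_add, map_smul,
      hTv] at h
    linear_combination (norm := module) h
  have hww : w ⊗ₜ[ℂ] w ≠ 0 := by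
    intro h
    refine hw0 ((Module.forall_dual_apply_eq_zero_iff ℂ w).mp fun f => ?_)
    simpa using congrArg (LinearMap.mul' ℂ ℂ ∘ₗ TensorProduct.map f f) h
  have hpoly : (q ^ 2 - 1) * (q ^ 2 + q) = 0 := by
    have h := LinearMap.congr_fun hrel2 (w ⊗ₜ[ℂ] w)
    simp only [LinearMap.comp_apply, LinearMap.sub_apply, LinearMap.add_apply,
      LinearMap.smul_apply, LinearMap.id_apply, LinearMap.zero_apply, map_add, map_smul,
      TensorProduct.map_tmul, hTw, TensorProduct.smul_tmul_smul] at h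
    refine (smul_eq_zero.mp ?_).resolve_right hww
    linear_combination (norm := module) h
  have hfac : (q - 1) * (q + 1) = 0 := by
    have h : (q * (q + 1)) * ((q - 1) * (q + 1)) = 0 := by linear_combination hpoly
    rcases mul_eq_zero.mp h with h | h
    · rw [(mul_eq_zero.mp h).resolve_left hq, mul_zero]
    · exact h
  rcases mul_eq_zero.mp hfac with h1 | h1
  · exact sub_eq_zero.mp h1
  · exfalso
    obtain rfl : q = -1 := eq_neg_of_add_eq_zero_left h1
    have hTw' : T w = w := by simpa using hTw
    have h := LinearMap.congr_fun hrel2 (v ⊗ₜ[ℂ] v)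
    simp only [LinearMap.comp_apply, LinearMap.sub_apply, LinearMap.add_apply,
      LinearMap.smul_apply, LinearMap.id_apply, LinearMap.zero_apply, map_add, map_smul,
      TensorProduct.map_tmul, hTv, hTw', TensorProduct.add_tmul, TensorProduct.tmul_add] at h
    have h2 : (2 : ℂ) • (w ⊗ₜ[ℂ] w) = 0 := by
      linear_combination (norm := module) h
    exact hww ((smul_eq_zero.mp h2).resolve_left two_ne_zero)
end

section
/- Let q and q′ be nonzero complex numbers, V a nonzero finite-dimensional complex vector space, and T an endomorphism of V satisfying (T − id)∘(T + q·id) = 0 and having a nonzero fixed vector (i.e. 1 is an eigenvalue of T). Suppose that for every finite-dimensional complex vector space W and every endomorphism S of W satisfying (S − id)∘(S + q′·id) = 0, the induced endomorphism T ⊗ S of V ⊗ W satisfies (T⊗S − id)∘(T⊗S + q·id) = 0. Then q = q′. -/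
open TensorProduct

/-- If `v` is a nonzero fixed vector of `T`, a relation `(X - id) ∘ (X + q • id) = 0` for
`X = T ⊗ S` restricts to the same relation for `S`. -/
theorem hecke_relation_of_map_of_fixed_vector {K V W : Type*} [Field K]
    [AddCommGroup V] [Module K V] [AddCommGroup W] [Module K W]
    {q : K} {T : V →ₗ[K] V} {S : W →ₗ[K] W} {v : V} (hv : v ≠ 0) (hTv : T v = v)
    (h : (TensorProduct.map T S - LinearMap.id) ∘ₗ
      (TensorProduct.map T S + q • LinearMap.id) = 0) :
    (S - LinearMap.id) ∘ₗ (S + q • LinearMap.id) = 0 := by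
  ext w
  have key : v ⊗ₜ[K] (((S - LinearMap.id) ∘ₗ (S + q • LinearMap.id)) w) = 0 := by
    simpa [hTv, TensorProduct.tmul_add, TensorProduct.tmul_sub] using
      LinearMap.congr_fun h (v ⊗ₜ[K] w)
  obtain ⟨f, hf⟩ := Module.Projective.exists_dual_eq_one K hv
  simpa [hf] using congrArg (TensorProduct.lid K W ∘ TensorProduct.map f LinearMap.id) key

/-- The endomorphism of `K × K` with matrix `!![1, 1; 0, -q]`. -/
def heckeBlock {K : Type*} [Field K] (q : K) : K × K →ₗ[K] K × K :=
  (LinearMap.fst K K K + LinearMap.snd K K K).prod (-q • LinearMap.snd K K K)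

theorem heckeBlock_apply {K : Type*} [Field K] (q : K) (x : K × K) :
    heckeBlock q x = (x.1 + x.2, -q * x.2) := rfl

theorem heckeBlock_relation_iff {K : Type*} [Field K] (q q' : K) :
    (heckeBlock q' - LinearMap.id) ∘ₗ (heckeBlock q' + q • LinearMap.id) = 0 ↔ q = q' := by
  constructor
  · intro h
    have := congrArg Prod.fst (LinearMap.congr_fun h (0, 1))
    simp [heckeBlock_apply] at this
    linear_combination this
  · rintro rfl
    refine LinearMap.ext fun x => Prod.ext ?_ ?_ <;> simp [heckeBlock_apply]

/-- Let `q, q'` be nonzero complex numbers, `V` a nonzero finite-dimensional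
complex vector space, and `T` an endomorphism of `V` satisfying `(T - id) ∘ (T + q • id) = 0`
and having a nonzero fixed vector. If for every finite-dimensional complex vector space `W`
and every endomorphism `S` of `W` satisfying `(S - id) ∘ (S + q' • id) = 0` the induced
endomorphism `T ⊗ S` of `V ⊗ W` satisfies `(T⊗S - id) ∘ (T⊗S + q • id) = 0`, then `q = q'`. -/
theorem two_param_hecke_fixed_vector
    (q q' : ℂ) (hq : q ≠ 0) (hq' : q' ≠ 0)
    (V : Type) [AddCommGroup V] [Module ℂ V] [FiniteDimensional ℂ V] [Nontrivial V]
    (T : V →ₗ[ℂ] V)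
    (hrel : (T - LinearMap.id) ∘ₗ (T + q • LinearMap.id) = 0)
    (hfix : ∃ v : V, v ≠ 0 ∧ T v = v)
    (h : ∀ (W : Type) [AddCommGroup W] [Module ℂ W] [FiniteDimensional ℂ W]
      (S : W →ₗ[ℂ] W),
      (S - LinearMap.id) ∘ₗ (S + q' • LinearMap.id) = 0 →
      (TensorProduct.map T S - LinearMap.id) ∘ₗ
        (TensorProduct.map T S + q • LinearMap.id) = 0) :
    q = q' := by
  obtain ⟨v, hv, hTv⟩ := hfix
  have hS := (heckeBlock_relation_iff q' q').2 rfl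
  exact (heckeBlock_relation_iff q q').1
    (hecke_relation_of_map_of_fixed_vector hv hTv (h (ℂ × ℂ) (heckeBlock q') hS))
end

section
/- Let q and q′ be nonzero complex numbers and V a nonzero finite-dimensional complex vector space, and let T = −q·id_V. Suppose that for every finite-dimensional complex vector space W and every endomorphism S of W satisfying (S − id)∘(S + q′·id) = 0, the induced endomorphism T ⊗ S of V ⊗ W satisfies (T⊗S − id)∘(T⊗S + q·id) = 0. Then either q = −1 and q′ = −1, or q·q′ = 1. -/
open TensorProduct

/-- If the scalar `c` on a nonzero space `V` is tensored with `S` and the result satisfies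
`(X - 1)(X + q) = 0`, then `c • S` satisfies the same relation. -/
theorem hecke_relation_of_map_smul_id {K V W : Type*} [Field K] [AddCommGroup V] [Module K V]
    [Nontrivial V] [AddCommGroup W] [Module K W] (c q : K) (S : W →ₗ[K] W)
    (h : (TensorProduct.map (c • LinearMap.id : V →ₗ[K] V) S - LinearMap.id) ∘ₗ
        (TensorProduct.map (c • LinearMap.id : V →ₗ[K] V) S + q • LinearMap.id) = 0) (w : W) :
    c • S (c • S w + q • w) - (c • S w + q • w) = 0 := by
  obtain ⟨v, hv⟩ := exists_ne (0 : V)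
  have hvw := LinearMap.congr_fun h (v ⊗ₜ[K] w)
  have key : v ⊗ₜ[K] (c • S (c • S w + q • w) - (c • S w + q • w)) = 0 := by
    rw [← LinearMap.zero_apply (σ₁₂ := RingHom.id K) (v ⊗ₜ[K] w), ← hvw]
    simp [TensorProduct.tmul_add, TensorProduct.tmul_sub, TensorProduct.smul_tmul, smul_comm c q]
  obtain ⟨f, hf⟩ := Module.Projective.exists_dual_ne_zero K hv
  have := congrArg (TensorProduct.lid K W ∘ TensorProduct.map f LinearMap.id) key
  simpa [hf] using this

/-- Let `q, q'` be nonzero complex numbers, `V` a nonzero finite-dimensional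
complex vector space, and `T = -q • id_V`. If for every finite-dimensional complex vector
space `W` and every endomorphism `S` of `W` satisfying `(S - id) ∘ (S + q' • id) = 0` the
induced endomorphism `T ⊗ S` of `V ⊗ W` satisfies `(T⊗S - id) ∘ (T⊗S + q • id) = 0`, then
either `q = -1` and `q' = -1`, or `q * q' = 1`. -/
theorem two_param_hecke_sign_eigenvalue
    (q q' : ℂ) (hq : q ≠ 0) (hq' : q' ≠ 0)
    (V : Type) [AddCommGroup V] [Module ℂ V] [FiniteDimensional ℂ V] [Nontrivial V]
    (T : V →ₗ[ℂ] V) (hT : T = (-q) • LinearMap.id)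
    (h : ∀ (W : Type) [AddCommGroup W] [Module ℂ W] [FiniteDimensional ℂ W]
      (S : W →ₗ[ℂ] W),
      (S - LinearMap.id) ∘ₗ (S + q' • LinearMap.id) = 0 →
      (TensorProduct.map T S - LinearMap.id) ∘ₗ
        (TensorProduct.map T S + q • LinearMap.id) = 0) :
    (q = -1 ∧ q' = -1) ∨ q * q' = 1 := by
  subst hT
  have hline := hecke_relation_of_map_smul_id (-q) q _
    (h ℂ ((-q') • LinearMap.id) (by ext; simp)) 1
  by_cases hq'' : q' = -1
  · left
    subst hq''
    refine ⟨?_, rfl⟩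
    have hblock := congrArg Prod.fst (hecke_relation_of_map_smul_id (-q) q _
      (h (ℂ × ℂ) (LinearMap.id + LinearMap.inl ℂ ℂ ℂ ∘ₗ LinearMap.snd ℂ ℂ ℂ)
        (by ext <;> simp)) (0, 1))
    simp at hblock
    have h3 : q * (q + 1) = 0 := by linear_combination hblock
    exact eq_neg_of_add_eq_zero_left ((mul_eq_zero.mp h3).resolve_left hq)
  · right
    simp at hline
    have h3 : q * (q' + 1) * (q * q' - 1) = 0 := by linear_combination hline
    have h4 : q' + 1 ≠ 0 := fun h0 => hq'' (eq_neg_of_add_eq_zero_left h0)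
    exact sub_eq_zero.mp ((mul_eq_zero.mp h3).resolve_left (mul_ne_zero hq h4))
end

section
/- Let R be a commutative ring, d ∈ R, M and N two R-modules, k a positive integer, and f : M → N an additive map such that for every x ∈ M one has Σ_{j=0}^{k} (−1)^j · C(k,j) · d^{k−j} · f(d^j · x) = 0, where C(k,j) is the binomial coefficient. Then there exists a unique additive map f̃ : M_d → N_d between the localizations of M and N at the powers of d such that f̃(x/1) = f(x)/1 for all x ∈ M and Σ_{j=0}^{k} (−1)^j · C(k,j) · d^{k−j} · f̃(d^j · ξ) = 0 for all ξ ∈ M_d. -/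
/-- Postcomposition with an endomorphism, as an endomorphism of the group of additive maps. -/
def postcomp {M Q : Type*} [AddCommGroup M] [AddCommGroup Q] (a : AddMonoid.End Q) :
    Module.End ℤ (M →+ Q) :=
  (AddMonoidHom.compHom a).toIntLinearMap

/-- Precomposition with an endomorphism, as an endomorphism of the group of additive maps. -/
def precomp {M Q : Type*} [AddCommGroup M] [AddCommGroup Q] (b : AddMonoid.End M) :
    Module.End ℤ (M →+ Q) :=
  (AddMonoidHom.compHom.flip b).toIntLinearMap

section

variable {M Q : Type*} [AddCommGroup M] [AddCommGroup Q]

theorem commute_postcomp_precomp (a : AddMonoid.End Q) (b : AddMonoid.End M) :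
    Commute (postcomp (M := M) a) (precomp b) := rfl

theorem postcomp_pow_apply (a : AddMonoid.End Q) (n : ℕ) (f : M →+ Q) (x : M) :
    (postcomp a ^ n) f x = (a ^ n) (f x) := by
  induction n generalizing f with
  | zero => rfl
  | succ n ih => rw [pow_succ, pow_succ, Module.End.mul_apply, ih]; rfl

theorem precomp_pow_apply (b : AddMonoid.End M) (n : ℕ) (f : M →+ Q) (x : M) :
    (precomp b ^ n) f x = f ((b ^ n) x) := by
  induction n generalizing f with
  | zero => rfl
  | succ n ih => rw [pow_succ, pow_succ', Module.End.mul_apply, ih]; rfl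

end

/-- `ad d f = d • f - f (d • ·)`, as an endomorphism of the group of additive maps. -/
def adSMul {R : Type*} [CommRing R] (d : R) (M Q : Type*) [AddCommGroup M] [Module R M]
    [AddCommGroup Q] [Module R Q] : Module.End ℤ (M →+ Q) :=
  postcomp (Module.toAddMonoidEnd R Q d) - precomp (Module.toAddMonoidEnd R M d)

section

variable {R M Q : Type*} [CommRing R] (d : R) [AddCommGroup M] [Module R M]
  [AddCommGroup Q] [Module R Q]

theorem adSMul_pow_apply (k : ℕ) (f : M →+ Q) (x : M) :
    (adSMul d M Q ^ k) f x = ∑ j ∈ Finset.range (k + 1),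
      ((-1 : ℤ) ^ j * (k.choose j : ℤ)) • (d ^ (k - j) • f (d ^ j • x)) := by
  have hcomm : Commute (-precomp (Module.toAddMonoidEnd R M d))
      (postcomp (M := M) (Module.toAddMonoidEnd R Q d)) :=
    (commute_postcomp_precomp _ _).symm.neg_left
  rw [adSMul, sub_eq_neg_add, hcomm.add_pow, LinearMap.sum_apply,
    AddMonoidHom.finsetSum_apply]
  refine Finset.sum_congr rfl fun j _ ↦ ?_
  have hcoeff : (-precomp (Q := Q) (Module.toAddMonoidEnd R M d)) ^ j *
      postcomp (Module.toAddMonoidEnd R Q d) ^ (k - j) * (k.choose j : Module.End ℤ (M →+ Q)) =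
      ((-1 : ℤ) ^ j * (k.choose j : ℤ)) • (postcomp (Module.toAddMonoidEnd R Q d) ^ (k - j) *
        precomp (Module.toAddMonoidEnd R M d) ^ j) := by
    rw [((commute_postcomp_precomp _ _).pow_pow _ _).eq, neg_pow, zsmul_eq_mul,
      ← (Nat.cast_commute _ _).eq]
    push_cast
    rw [(Nat.cast_commute (k.choose j) ((-1 : Module.End ℤ (M →+ Q)) ^ j)).symm.eq]
    simp only [mul_assoc]
  rw [hcoeff, LinearMap.smul_apply, AddMonoidHom.zsmul_apply, Module.End.mul_apply,
    postcomp_pow_apply, precomp_pow_apply, ← map_pow, ← map_pow]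
  rfl

/-- If `d` acts invertibly on `Q`, then precomposition with `d` is invertible on the additive maps
annihilated by `(ad d) ^ k`. -/
theorem exists_inverse_precomp_on_ker_adSMul_pow
    (hd : IsUnit (algebraMap R (Module.End R Q) d)) (k : ℕ) :
    ∃ T : Module.End ℤ (M →+ Q), Commute (adSMul d M Q) T ∧
      ∀ f : M →+ Q, (adSMul d M Q ^ k) f = 0 →
        precomp (Module.toAddMonoidEnd R M d) (T f) = f ∧
        T (precomp (Module.toAddMonoidEnd R M d) f) = f := by
  obtain ⟨u, hu⟩ := hd
  set L := postcomp (M := M) (Module.toAddMonoidEnd R Q d) with hL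
  set P := precomp (Q := Q) (Module.toAddMonoidEnd R M d) with hP
  set I := postcomp (M := M) (u⁻¹ : (Module.End R Q)ˣ).val.toAddMonoidHom with hI
  have hIL : I * L = 1 := by
    ext f x
    have h := LinearMap.congr_fun u.inv_mul (f x)
    rw [hu] at h
    exact h
  have hLI : L * I = 1 := by
    ext f x
    have h := LinearMap.congr_fun u.mul_inv (f x)
    rw [hu] at h
    exact h
  have hA : adSMul d M Q = L - P := rfl
  have cIL : Commute I L := hIL.trans hLI.symm
  have cIP : Commute I P := commute_postcomp_precomp _ _
  have cLP : Commute L P := commute_postcomp_precomp _ _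
  have cIA : Commute I (adSMul d M Q) := cIL.sub_right cIP
  have cPA : Commute P (adSMul d M Q) := cLP.symm.sub_right (Commute.refl P)
  set B := I * adSMul d M Q with hB
  have cBA : Commute B (adSMul d M Q) := cIA.mul_left (Commute.refl _)
  have cPB : Commute P B := cIP.symm.mul_right cPA
  have hIP : I * P = 1 - B := by rw [hB, hA, mul_sub, hIL, sub_sub_cancel]
  set S := ∑ i ∈ Finset.range k, B ^ i with hS
  have cAS : Commute (adSMul d M Q) S := Commute.sum_right _ _ _ fun i _ ↦ (cBA.pow_left i).symm
  have cPS : Commute P S := Commute.sum_right _ _ _ fun i _ ↦ cPB.pow_right i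
  have hPT : P * (I * S) = 1 - B ^ k := by
    rw [← mul_assoc, ← cIP.eq, hIP, mul_neg_geom_sum]
  have hTP : I * S * P = 1 - B ^ k := by
    rw [mul_assoc, ← cPS.eq, ← mul_assoc, hIP, mul_neg_geom_sum]
  refine ⟨I * S, cIA.symm.mul_right cAS, fun f hf ↦ ?_⟩
  have hBf : (B ^ k) f = 0 := by
    rw [hB, cIA.mul_pow, Module.End.mul_apply, hf, map_zero]
  have hfix : (1 - B ^ k) f = f := by
    rw [LinearMap.sub_apply, hBf, sub_zero, Module.End.one_apply]
  exact ⟨by rw [← Module.End.mul_apply, hPT, hfix],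
    by rw [← Module.End.mul_apply, hTP, hfix]⟩

end

/-- A sequence of additive maps `g n` with `g (n + 1) (d • x) = g n x` glues to an additive map on
the localization at the powers of `d`, whose value at `x / d ^ n` is `g n x`. -/
theorem exists_addMonoidHom_localizedModule_powers {R M Q : Type*} [CommRing R] (d : R)
    [AddCommGroup M] [Module R M] [AddCommGroup Q] (g : ℕ → M →+ Q)
    (hg : ∀ n x, g (n + 1) (d • x) = g n x) :
    ∃ G : LocalizedModule (Submonoid.powers d) M →+ Q,
      ∀ n x, G (LocalizedModule.mk x (⟨d ^ n, n, rfl⟩ : Submonoid.powers d)) = g n x := by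
  have hshift (c n : ℕ) (x : M) : g (n + c) (d ^ c • x) = g n x := by
    induction c generalizing x with
    | zero => simp
    | succ c ih => rw [pow_succ', mul_smul, ← add_assoc, hg, ih]
  have hwd (x y : M) (n m c : ℕ) (h : d ^ c • d ^ m • x = d ^ c • d ^ n • y) :
      g n x = g m y := by
    rw [← hshift (c + m) n x, ← hshift (c + n) m y, pow_add, pow_add, mul_smul, mul_smul, h,
      show n + (c + m) = m + (c + n) by lia]
  let G : LocalizedModule (Submonoid.powers d) M → Q := fun ξ ↦
    LocalizedModule.liftOn ξ (fun p ↦ g p.2.2.choose p.1) (by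
      rintro ⟨x, s⟩ ⟨y, t⟩ ⟨⟨_, c, rfl⟩, h⟩
      refine hwd x y _ _ c ?_
      have hs : d ^ s.2.choose = s := s.2.choose_spec
      have ht : d ^ t.2.choose = t := t.2.choose_spec
      change d ^ c • d ^ t.2.choose • x = d ^ c • d ^ s.2.choose • y
      rw [hs, ht]
      exact h)
  have hG (n : ℕ) (x : M) :
      G (LocalizedModule.mk x (⟨d ^ n, n, rfl⟩ : Submonoid.powers d)) = g n x := by
    let s : Submonoid.powers d := ⟨d ^ n, n, rfl⟩
    refine hwd x x s.2.choose n 0 ?_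
    have hs : d ^ s.2.choose = d ^ n := s.2.choose_spec
    change _ = d ^ 0 • d ^ s.2.choose • x
    rw [hs]
  refine ⟨AddMonoidHom.mk' G fun ξ η ↦ ?_, hG⟩
  induction ξ using LocalizedModule.induction_on with | _ x s
  induction η using LocalizedModule.induction_on with | _ y t
  obtain ⟨_, n, rfl⟩ := s
  obtain ⟨_, m, rfl⟩ := t
  have hmul : (⟨d ^ n, n, rfl⟩ * ⟨d ^ m, m, rfl⟩ : Submonoid.powers d) =
      ⟨d ^ (n + m), n + m, rfl⟩ := Subtype.ext (pow_add d n m).symm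
  rw [LocalizedModule.mk_add_mk, hmul, hG, hG, hG, map_add]
  congr 1
  · exact hshift m n x
  · rw [add_comm n m]
    exact hshift n m y

/-- Let `R` be a commutative ring, `d ∈ R`, `M` and `N` two `R`-modules,
`k` a positive integer, and `f : M → N` an additive map such that for every `x ∈ M` one has
`∑ j in range (k+1), (-1)^j * C(k,j) • (d^(k-j) • f (d^j • x)) = 0` (i.e. `(ad d)^k f = 0`).
Then there is a unique additive map `f̃` between the localizations of `M` and `N` at the
powers of `d` with `f̃(x/1) = f(x)/1` and satisfying the same identity on the localization. -/
theorem ad_nilpotent_map_extends_to_localization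
    (R : Type) [CommRing R] (d : R)
    (M N : Type) [AddCommGroup M] [Module R M] [AddCommGroup N] [Module R N]
    (k : ℕ) (hk : 0 < k) (f : M →+ N)
    (hf : ∀ x : M, ∑ j ∈ Finset.range (k + 1),
      ((-1 : ℤ) ^ j * (k.choose j : ℤ)) • (d ^ (k - j) • f (d ^ j • x)) = 0) :
    ∃! g : LocalizedModule (Submonoid.powers d) M →+ LocalizedModule (Submonoid.powers d) N,
      (∀ x : M, g (LocalizedModule.mk x 1) = LocalizedModule.mk (f x) 1) ∧
      (∀ ξ : LocalizedModule (Submonoid.powers d) M,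
        ∑ j ∈ Finset.range (k + 1),
          ((-1 : ℤ) ^ j * (k.choose j : ℤ)) • (d ^ (k - j) • g (d ^ j • ξ)) = 0) := by
  set S := Submonoid.powers d
  have hd : IsUnit (algebraMap R (Module.End R (LocalizedModule S N)) d) :=
    IsLocalizedModule.map_units (LocalizedModule.mkLinearMap S N) ⟨d, Submonoid.mem_powers d⟩
  obtain ⟨T, hT, hinv⟩ := exists_inverse_precomp_on_ker_adSMul_pow (M := M) d hd k
  let f₀ : M →+ LocalizedModule S N := (LocalizedModule.mkLinearMap S N).toAddMonoidHom.comp f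
  have hf₀ : (adSMul d M (LocalizedModule S N) ^ k) f₀ = 0 := by
    ext x
    rw [adSMul_pow_apply, AddMonoidHom.zero_apply,
      ← map_zero (LocalizedModule.mkLinearMap S N), ← hf x, map_sum]
    refine Finset.sum_congr rfl fun j _ ↦ ?_
    have h := (LocalizedModule.mkLinearMap S N).map_smul (d ^ (k - j)) (f (d ^ j • x))
    rw [map_zsmul, h]
    rfl
  have hker (n : ℕ) : (adSMul d M (LocalizedModule S N) ^ k) ((T ^ n) f₀) = 0 := by
    rw [← Module.End.mul_apply, (hT.pow_pow k n).eq, Module.End.mul_apply, hf₀, map_zero]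
  have hstep (n : ℕ) (x : M) : (T ^ (n + 1)) f₀ (d • x) = (T ^ n) f₀ x := by
    rw [pow_succ']
    exact DFunLike.congr_fun (hinv _ (hker n)).1 x
  obtain ⟨G, hG⟩ := exists_addMonoidHom_localizedModule_powers d (fun n ↦ (T ^ n) f₀) hstep
  have hone : (1 : S) = ⟨d ^ 0, 0, rfl⟩ := Subtype.ext (pow_zero d).symm
  refine ⟨G, ⟨fun x ↦ ?_, fun ξ ↦ ?_⟩, fun g ⟨hg₁, hg₂⟩ ↦ ?_⟩
  · rw [hone, hG, ← hone]
    rfl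
  · induction ξ using LocalizedModule.induction_on with | _ x s
    obtain ⟨_, n, rfl⟩ := s
    rw [← AddMonoidHom.zero_apply (M := M) x, ← hker n, adSMul_pow_apply]
    refine Finset.sum_congr rfl fun j _ ↦ ?_
    rw [LocalizedModule.smul'_mk, hG]
  · let h (n : ℕ) : M →+ LocalizedModule S N := AddMonoidHom.mk'
      (fun x ↦ g (LocalizedModule.mk x ⟨d ^ n, n, rfl⟩)) fun x y ↦ by
        rw [← map_add]
        exact congrArg g (OreLocalization.add_oreDiv.symm)
    have hh (n : ℕ) : h n = (T ^ n) f₀ := by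
      induction n with
      | zero =>
        ext x
        change g (LocalizedModule.mk x ⟨d ^ 0, 0, rfl⟩) = _
        rw [← hone, hg₁]
        rfl
      | succ n ih =>
        have hhker : (adSMul d M (LocalizedModule S N) ^ k) (h (n + 1)) = 0 := by
          ext x
          rw [adSMul_pow_apply, AddMonoidHom.zero_apply,
            ← hg₂ (LocalizedModule.mk x ⟨d ^ (n + 1), n + 1, rfl⟩)]
          refine Finset.sum_congr rfl fun j _ ↦ ?_
          rw [LocalizedModule.smul'_mk]
          rfl
        have hpre : precomp (Module.toAddMonoidEnd R M d) (h (n + 1)) = h n := by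
          ext x
          refine congrArg g (LocalizedModule.mk_eq.mpr ⟨1, ?_⟩)
          simp only [one_smul]
          change d ^ n • d • x = d ^ (n + 1) • x
          rw [pow_succ, mul_smul]
        rw [← (hinv _ hhker).2, hpre, ih, pow_succ', Module.End.mul_apply]
    ext ξ
    induction ξ using LocalizedModule.induction_on with | _ x s
    obtain ⟨_, n, rfl⟩ := s
    rw [hG, ← hh]
    rfl
end

section
/- Let 𝒜 be a ℂ-linear abelian category with finite-dimensional Hom spaces, and let 0 → J → H → M → 0 be a short exact sequence in 𝒜 such that Hom(H, J) = 0, Hom(J, J) is one-dimensional, Ext¹(M, J) is one-dimensional, and Ext¹(J, J) = 0. Then Ext¹(H, J) = 0, i.e. every short exact sequence 0 → J → X → H → 0 splits. -/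
open CategoryTheory CategoryTheory.Limits

/-- A pair of composable morphisms forming a short exact sequence `0 → A → X → B → 0`. -/
def IsSES {𝒜 : Type u} [Category.{v} 𝒜] [Abelian 𝒜] {A X B : 𝒜}
    (i : A ⟶ X) (p : X ⟶ B) : Prop :=
  ∃ w : i ≫ p = 0, (ShortComplex.mk i p w).ShortExact

/-- A short exact sequence `0 → A → X → B → 0` splits if the monomorphism `A → X`
admits a retraction. -/
def SESSplits {𝒜 : Type u} [Category.{v} 𝒜] [Abelian 𝒜] {A X B : 𝒜}
    (i : A ⟶ X) (_p : X ⟶ B) : Prop :=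
  ∃ r : X ⟶ A, i ≫ r = 𝟙 A

/-- If the pullback along `i : K ⟶ B` of the extension `0 → A → X → B → 0` splits whenever it is
an extension, then `i` lifts to `X`. -/
lemma IsSES.exists_lift {𝒜 : Type u} [Category.{v} 𝒜] [Abelian 𝒜] {A X B K : 𝒜}
    {a : A ⟶ X} {b : X ⟶ B} (hab : IsSES a b) (i : K ⟶ B)
    (hsplit : ∀ (P : 𝒜) (a' : A ⟶ P) (b' : P ⟶ K), IsSES a' b' → SESSplits a' b') :
    ∃ s : K ⟶ X, s ≫ b = i := by
  obtain ⟨w, hS⟩ := hab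
  have : Mono a := hS.mono_f
  have : Epi b := hS.epi_g
  let a' : A ⟶ pullback i b := pullback.lift 0 a (by simp [w])
  have ha' : a' ≫ pullback.snd i b = a := pullback.lift_snd _ _ _
  have w' : a' ≫ pullback.fst i b = 0 := pullback.lift_fst _ _ _
  have : Mono a' := by
    have : Mono (a' ≫ pullback.snd i b) := by rwa [ha']
    exact mono_of_mono a' (pullback.snd i b)
  have hex : (ShortComplex.mk a' (pullback.fst i b) w').Exact := by
    refine ShortComplex.exact_of_f_is_kernel _
      (KernelFork.IsLimit.ofι' _ _ fun {Z} k hk => ⟨hS.exact.lift (k ≫ pullback.snd i b) ?_, ?_⟩)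
    · change (k ≫ pullback.snd i b) ≫ b = 0
      rw [Category.assoc, ← pullback.condition, reassoc_of% hk, zero_comp]
    · have h := hS.exact.lift_f (k ≫ pullback.snd i b)
        (by
          change (k ≫ pullback.snd i b) ≫ b = 0
          rw [Category.assoc, ← pullback.condition, reassoc_of% hk, zero_comp])
      apply pullback.hom_ext
      · simp [w', hk]
      · simpa [ha'] using h
  have hP : (ShortComplex.mk a' (pullback.fst i b) w').ShortExact :=
    { exact := hex, mono_f := ‹_›, epi_g := inferInstanceAs (Epi (pullback.fst i b)) }
  obtain ⟨r, hr⟩ := hsplit _ _ _ ⟨w', hP⟩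
  let σ := ShortComplex.Splitting.ofExactOfRetraction _ hex r hr hP.epi_g
  refine ⟨σ.s ≫ pullback.snd i b, ?_⟩
  rw [Category.assoc, ← pullback.condition, ← Category.assoc]
  simpa using congrArg (· ≫ i) σ.s_g

/-- Dividing an extension of `H` by `J` by a lift of the subobject `K` of `H` yields an extension
of `H / K` by `J`. -/
lemma IsSES.cokernel_of_lift {𝒜 : Type u} [Category.{v} 𝒜] [Abelian 𝒜] {J K X H M : 𝒜}
    {i : K ⟶ H} {p : H ⟶ M} (hip : IsSES i p) {a : J ⟶ X} {b : X ⟶ H} (hab : IsSES a b)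
    {s : K ⟶ X} (hs : s ≫ b = i) :
    ∃ q : cokernel s ⟶ M, cokernel.π s ≫ q = b ≫ p ∧ IsSES (a ≫ cokernel.π s) q := by
  obtain ⟨w, hS⟩ := hab
  obtain ⟨w', hT⟩ := hip
  have : Mono a := hS.mono_f
  have : Epi b := hS.epi_g
  have : Mono i := hT.mono_f
  have : Epi p := hT.epi_g
  have : Mono s := by
    have : Mono (s ≫ b) := by rwa [hs]
    exact mono_of_mono s b
  let q : cokernel s ⟶ M := cokernel.desc s (b ≫ p) (by rw [reassoc_of% hs, w'])
  have hq : cokernel.π s ≫ q = b ≫ p := cokernel.π_desc _ _ _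
  have : Epi q := by
    have : Epi (cokernel.π s ≫ q) := by rw [hq]; infer_instance
    exact epi_of_epi (cokernel.π s) q
  have hmono : Mono (a ≫ cokernel.π s) := by
    refine Preadditive.mono_of_cancel_zero _ fun {Z} f hf => ?_
    have hker := ShortComplex.exact_cokernel s
    have hf' : (f ≫ a) ≫ cokernel.π s = 0 := by rw [Category.assoc, hf]
    have h : hker.lift (f ≫ a) hf' ≫ s = f ≫ a := hker.lift_f _ _
    have h0 : hker.lift (f ≫ a) hf' = 0 := by
      rw [← cancel_mono i, ← hs, reassoc_of% h, w, comp_zero, zero_comp]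
    rw [h0, zero_comp] at h
    rw [← cancel_mono a, ← h, zero_comp]
  have wq : (a ≫ cokernel.π s) ≫ q = 0 := by rw [Category.assoc, hq, reassoc_of% w, zero_comp]
  have hex : (ShortComplex.mk (a ≫ cokernel.π s) q wq).Exact := by
    refine ShortComplex.exact_of_g_is_cokernel _
      (CokernelCofork.IsColimit.ofπ' _ _ fun {Z} h hh => Nonempty.some ?_)
    have h1 : a ≫ cokernel.π s ≫ h = 0 := by simpa using hh
    obtain ⟨h', hh'⟩ : ∃ h' : H ⟶ Z, b ≫ h' = cokernel.π s ≫ h :=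
      ⟨hS.exact.desc _ h1, hS.exact.g_desc _ h1⟩
    have h2 : i ≫ h' = 0 := by
      rw [← hs, Category.assoc, hh', cokernel.condition_assoc, zero_comp]
    obtain ⟨k, hk⟩ : ∃ k : M ⟶ Z, p ≫ k = h' := ⟨hT.exact.desc _ h2, hT.exact.g_desc _ h2⟩
    refine ⟨⟨k, ?_⟩⟩
    change q ≫ k = h
    rw [← cancel_epi (cokernel.π s), reassoc_of% hq, hk, hh']
  exact ⟨q, hq, wq, { exact := hex, mono_f := hmono, epi_g := ‹Epi q› }⟩

/-- A morphism of extensions which is the identity on the subobject and a nonzero scalar on the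
quotient is an isomorphism. -/
lemma IsSES.isIso_of_smul {R : Type*} [Field R] {𝒜 : Type u} [Category.{v} 𝒜] [Abelian 𝒜]
    [Linear R 𝒜] {J Y E M : 𝒜} {j : J ⟶ Y} {q : Y ⟶ M} {a : J ⟶ E} {b : E ⟶ M}
    (hjq : IsSES j q) (hab : IsSES a b) {c : R} (hc : c ≠ 0) {ψ : Y ⟶ E}
    (hj : j ≫ ψ = a) (hb : ψ ≫ b = q ≫ (c • 𝟙 M)) : IsIso ψ := by
  obtain ⟨w, hS⟩ := hjq
  obtain ⟨w', hT⟩ := hab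
  have : IsIso (c • 𝟙 M) := ⟨c⁻¹ • 𝟙 M, by simp [smul_smul, hc], by simp [smul_smul, hc]⟩
  let φ : ShortComplex.mk j q w ⟶ ShortComplex.mk a b w' :=
    { τ₁ := 𝟙 J, τ₂ := ψ, τ₃ := c • 𝟙 M, comm₁₂ := by simp [hj], comm₂₃ := hb }
  have : IsIso φ.τ₁ := inferInstanceAs (IsIso (𝟙 J))
  have : IsIso φ.τ₃ := ‹IsIso (c • 𝟙 M)›
  exact ShortComplex.isIso₂_of_shortExact_of_isIso₁₃ φ hS hT

/-- Let `𝒜` be a `ℂ`-linear abelian category with finite-dimensional Hom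
spaces and `0 → J → H → M → 0` a short exact sequence with `Hom(H, J) = 0`, `Hom(J, J)`
one-dimensional, `Ext¹(M, J)` one-dimensional (there is a non-split extension `0 → J → E → M → 0`
and every extension of `M` by `J` either splits or is equivalent to the pullback of it along
`c • 𝟙 M` for some `c ≠ 0`), and `Ext¹(J, J) = 0`. Then `Ext¹(H, J) = 0`, i.e. every short
exact sequence `0 → J → X → H → 0` splits. -/
theorem ext_H_J_vanishes
    {𝒜 : Type u} [Category.{v} 𝒜] [Abelian 𝒜] [Linear ℂ 𝒜]
    [∀ X Y : 𝒜, FiniteDimensional ℂ (X ⟶ Y)]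
    {J H M : 𝒜} (i : J ⟶ H) (p : H ⟶ M) (hses : IsSES i p)
    (hHJ : ∀ f : H ⟶ J, f = 0)
    (hJJ : (∀ f : J ⟶ J, ∃ c : ℂ, f = c • 𝟙 J) ∧ 𝟙 J ≠ 0)
    (hExtMJ : ∃ (E : 𝒜) (a : J ⟶ E) (b : E ⟶ M), IsSES a b ∧ ¬ SESSplits a b ∧
      ∀ (Y : 𝒜) (j : J ⟶ Y) (q : Y ⟶ M), IsSES j q →
        (SESSplits j q ∨
          ∃ c : ℂ, c ≠ 0 ∧ ∃ ψ : Y ⟶ E, j ≫ ψ = a ∧ ψ ≫ b = q ≫ (c • 𝟙 M)))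
    (hExtJJ : ∀ (X : 𝒜) (a : J ⟶ X) (b : X ⟶ J), IsSES a b → SESSplits a b) :
    ∀ (X : 𝒜) (a : J ⟶ X) (b : X ⟶ H), IsSES a b → SESSplits a b := by
  intro X a b hab
  obtain ⟨E, aE, bE, hE, -, hE'⟩ := hExtMJ
  obtain ⟨s, hs⟩ := hab.exists_lift i hExtJJ
  obtain ⟨q, hq, hY⟩ := hses.cokernel_of_lift hab hs
  rcases hE' _ _ _ hY with ⟨r, hr⟩ | ⟨c, -, ψ, hψ, hψ'⟩
  · exact ⟨cokernel.π s ≫ r, by rw [← Category.assoc, hr]⟩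
  rcases hE' _ _ _ hses with ⟨r, hr⟩ | ⟨d, hd, θ, hθ, hθ'⟩
  · exact absurd (by rw [← hr, hHJ r, comp_zero]) hJJ.2
  have : IsIso θ := hses.isIso_of_smul hE hd hθ hθ'
  have hθinv : inv θ ≫ p = d⁻¹ • bE := by
    rw [IsIso.inv_comp_eq, Linear.comp_smul, hθ']
    simp [smul_smul, hd]
  obtain ⟨_, hS⟩ := hses
  have : Mono i := hS.mono_f
  have hf : (cokernel.π s ≫ ψ ≫ inv θ - (d⁻¹ * c) • b) ≫ p = 0 := by
    simp [hθinv, hψ', hq, smul_smul]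
  obtain ⟨r, hr⟩ : ∃ r : X ⟶ J, r ≫ i = cokernel.π s ≫ ψ ≫ inv θ - (d⁻¹ * c) • b :=
    ⟨hS.exact.lift _ hf, hS.exact.lift_f _ hf⟩
  refine ⟨r, ?_⟩
  rw [← cancel_mono i, Category.assoc, hr, Category.id_comp, Preadditive.comp_sub,
    Linear.comp_smul, hab.1, smul_zero, sub_zero]
  rw [Category.assoc] at hψ
  rw [reassoc_of% hψ, ← hθ, Category.assoc, IsIso.hom_inv_id, Category.comp_id]
end

section
/- Let 𝒜 be an abelian category, M and J simple objects of 𝒜 with M not isomorphic to J, and let 0 → J → H → M → 0 and 0 → M → D → J → 0 be non-split short exact sequences. Assume: (a) every short exact sequence 0 → J → Y → M → 0 either splits or has Y ≅ H; (b) every short exact sequence 0 → M → Y → J → 0 either splits or has Y ≅ D; (c) every short exact sequence 0 → M → X → H → 0 splits; and (d) every short exact sequence 0 → M → X → M → 0 splits. Then every short exact sequence 0 → D → X → M → 0 splits. -/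
open CategoryTheory CategoryTheory.Limits

section ShortExactSequences

variable {𝒜 : Type u} [Category.{v} 𝒜] [Abelian 𝒜]

/-- A mono-epi pair with zero composite is a short exact sequence as soon as every generalized
element killed by the epi lifts along the mono after a refinement. -/
lemma IsSES.of_refinements {A X B : 𝒜} (i : A ⟶ X) (p : X ⟶ B) [Mono i] [Epi p]
    (w : i ≫ p = 0)
    (h : ∀ ⦃T : 𝒜⦄ (x : T ⟶ X), x ≫ p = 0 →
      ∃ (T' : 𝒜) (π : T' ⟶ T) (_ : Epi π) (y : T' ⟶ A), π ≫ x = y ≫ i) :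
    IsSES i p :=
  ⟨w, { exact := (ShortComplex.exact_iff_exact_up_to_refinements _).2 h }⟩

lemma IsSES.mono {A X B : 𝒜} {i : A ⟶ X} {p : X ⟶ B} (h : IsSES i p) : Mono i :=
  h.choose_spec.mono_f

lemma IsSES.epi {A X B : 𝒜} {i : A ⟶ X} {p : X ⟶ B} (h : IsSES i p) : Epi p :=
  h.choose_spec.epi_g

lemma IsSES.exists_lift_s10 {A X B : 𝒜} {i : A ⟶ X} {p : X ⟶ B} (h : IsSES i p)
    {T : 𝒜} (x : T ⟶ X) (hx : x ≫ p = 0) : ∃ y : T ⟶ A, y ≫ i = x :=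
  have := h.mono
  ⟨h.choose_spec.exact.lift x hx, h.choose_spec.exact.lift_f x hx⟩

lemma IsSES.exists_desc {A X B : 𝒜} {i : A ⟶ X} {p : X ⟶ B} (h : IsSES i p)
    {T : 𝒜} (x : X ⟶ T) (hx : i ≫ x = 0) : ∃ y : B ⟶ T, p ≫ y = x :=
  have := h.epi
  ⟨h.choose_spec.exact.desc x hx, h.choose_spec.exact.g_desc x hx⟩

lemma IsSES.cokernel {A X : 𝒜} (i : A ⟶ X) [Mono i] : IsSES i (cokernel.π i) :=
  ⟨cokernel.condition i, { exact := ShortComplex.exact_cokernel i }⟩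

lemma IsSES.comp_iso {A X B C : 𝒜} {i : A ⟶ X} {p : X ⟶ B} (h : IsSES i p) (e : B ≅ C) :
    IsSES i (p ≫ e.hom) :=
  have w : i ≫ p ≫ e.hom = 0 := by rw [← Category.assoc, h.choose, zero_comp]
  let φ : ShortComplex.mk i p h.choose ≅ ShortComplex.mk i (p ≫ e.hom) w :=
    ShortComplex.isoMk (Iso.refl _) (Iso.refl _) e (by simp) (by simp)
  ⟨w, ShortComplex.shortExact_of_iso φ h.choose_spec⟩

lemma IsSES.splits_iff_exists_section {A X B : 𝒜} {i : A ⟶ X} {p : X ⟶ B} (h : IsSES i p) :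
    SESSplits i p ↔ ∃ s : B ⟶ X, s ≫ p = 𝟙 B := by
  obtain ⟨w, hS⟩ := h
  constructor
  · rintro ⟨r, hr⟩
    let σ := ShortComplex.Splitting.ofExactOfRetraction _ hS.exact r hr hS.epi_g
    exact ⟨σ.s, σ.s_g⟩
  · rintro ⟨s, hs⟩
    let σ := ShortComplex.Splitting.ofExactOfSection _ hS.exact s hs hS.mono_f
    exact ⟨σ.r, σ.f_r⟩

/-- Quotienting an extension of `B` by `D` by a subobject `A` of `D` gives an extension of `B`
by `D / A`. -/
lemma IsSES.exists_quotient {A D C X B Y : 𝒜} {i : A ⟶ D} {p : D ⟶ C} (hD : IsSES i p)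
    {a : D ⟶ X} {b : X ⟶ B} (hX : IsSES a b) {q : X ⟶ Y} (hq : IsSES (i ≫ a) q) :
    ∃ (j : C ⟶ Y) (g : Y ⟶ B), p ≫ j = a ≫ q ∧ q ≫ g = b ∧ IsSES j g := by
  have := hD.epi
  have := hX.mono
  have := hX.epi
  have := hq.epi
  obtain ⟨j, hj⟩ := hD.exists_desc (a ≫ q) (by rw [← Category.assoc, hq.choose])
  obtain ⟨g, hg⟩ := hq.exists_desc b (by rw [Category.assoc, hX.choose, comp_zero])
  have : Mono j := by
    refine Preadditive.mono_of_cancel_zero _ fun {T} t ht => ?_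
    obtain ⟨T', π, _, d, hd⟩ := surjective_up_to_refinements_of_epi p t
    obtain ⟨m, hm⟩ := hq.exists_lift_s10 (d ≫ a) (by
      rw [Category.assoc, ← hj, ← Category.assoc, ← hd, Category.assoc, ht, comp_zero])
    have hm' : m ≫ i = d := by rw [← cancel_mono a, Category.assoc, hm]
    rw [← cancel_epi π, hd, ← hm', Category.assoc, hD.choose, comp_zero, comp_zero]
  have : Epi g := by
    have : Epi (q ≫ g) := by rw [hg]; infer_instance
    exact epi_of_epi q g
  refine ⟨j, g, hj, hg, IsSES.of_refinements j g ?_ fun T y hy => ?_⟩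
  · rw [← cancel_epi p, reassoc_of% hj, hg, hX.choose, comp_zero]
  · obtain ⟨T', π, hπ, x, hx⟩ := surjective_up_to_refinements_of_epi q y
    obtain ⟨d, hd⟩ := hX.exists_lift_s10 x (by
      rw [← hg, ← Category.assoc, ← hx, Category.assoc, hy, comp_zero])
    exact ⟨T', π, hπ, d ≫ p, by rw [hx, ← hd, Category.assoc, Category.assoc, hj]⟩

/-- If `0 → A → D → C → 0` and `0 → D → X → B → 0` are short exact and `D ⟶ C` extends to
`t : X ⟶ C`, then the kernel of `t` is an extension of `B` by `A`. -/
lemma IsSES.exists_kernel {A D C X B : 𝒜} {i : A ⟶ D} {p : D ⟶ C} (hD : IsSES i p)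
    {a : D ⟶ X} {b : X ⟶ B} (hX : IsSES a b) (t : X ⟶ C) (ht : a ≫ t = p) :
    ∃ k : A ⟶ kernel t, IsSES k (kernel.ι t ≫ b) := by
  have := hD.mono
  have := hD.epi
  have := hX.mono
  have := hX.epi
  let k : A ⟶ kernel t := kernel.lift t (i ≫ a) (by rw [Category.assoc, ht, hD.choose])
  have hk : k ≫ kernel.ι t = i ≫ a := kernel.lift_ι _ _ _
  have : Mono k := by
    have : Mono (k ≫ kernel.ι t) := by rw [hk]; infer_instance
    exact mono_of_mono k (kernel.ι t)
  have : Epi (kernel.ι t ≫ b) := by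
    rw [epi_iff_surjective_up_to_refinements]
    intro T m
    obtain ⟨T₁, π₁, _, x, hx⟩ := surjective_up_to_refinements_of_epi b m
    obtain ⟨T₂, π₂, _, d, hd⟩ := surjective_up_to_refinements_of_epi p (x ≫ t)
    refine ⟨T₂, π₂ ≫ π₁, inferInstance, kernel.lift t (π₂ ≫ x - d ≫ a) ?_, ?_⟩
    · rw [Preadditive.sub_comp, Category.assoc, Category.assoc, ht, hd, sub_self]
    · rw [kernel.lift_ι_assoc, Preadditive.sub_comp, Category.assoc, Category.assoc,
        Category.assoc, hX.choose, comp_zero, sub_zero, hx]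
  refine ⟨k, IsSES.of_refinements k _ ?_ fun T z hz => ?_⟩
  · rw [reassoc_of% hk, hX.choose, comp_zero]
  · obtain ⟨d, hd⟩ := hX.exists_lift_s10 (z ≫ kernel.ι t) (by rw [Category.assoc, hz])
    obtain ⟨m, hm⟩ := hD.exists_lift_s10 d (by
      rw [← ht, ← Category.assoc, hd, Category.assoc, kernel.condition, comp_zero])
    refine ⟨T, 𝟙 T, inferInstance, m, ?_⟩
    rw [← cancel_mono (kernel.ι t), Category.id_comp, Category.assoc, hk, ← hd, ← hm,
      Category.assoc]

end ShortExactSequences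

/-- Let `𝒜` be an abelian category, `M` and `J` non-isomorphic simple
objects, `0 → J → H → M → 0` and `0 → M → D → J → 0` non-split short exact sequences.
Assume: (a) every extension of `M` by `J` splits or has middle term `≅ H`; (b) every
extension of `J` by `M` splits or has middle term `≅ D`; (c) every sequence
`0 → M → X → H → 0` splits; (d) every sequence `0 → M → X → M → 0` splits. Then every
short exact sequence `0 → D → X → M → 0` splits. -/
theorem ext_M_D_vanishes
    {𝒜 : Type u} [Category.{v} 𝒜] [Abelian 𝒜]
    {M J : 𝒜} [Simple M] [Simple J] (hMJ : IsEmpty (M ≅ J))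
    {H : 𝒜} (iH : J ⟶ H) (pH : H ⟶ M) (hH : IsSES iH pH) (hHns : ¬ SESSplits iH pH)
    {D : 𝒜} (iD : M ⟶ D) (pD : D ⟶ J) (hD : IsSES iD pD) (hDns : ¬ SESSplits iD pD)
    (ha : ∀ (Y : 𝒜) (j : J ⟶ Y) (q : Y ⟶ M), IsSES j q →
      SESSplits j q ∨ Nonempty (Y ≅ H))
    (hb : ∀ (Y : 𝒜) (j : M ⟶ Y) (q : Y ⟶ J), IsSES j q →
      SESSplits j q ∨ Nonempty (Y ≅ D))
    (hc : ∀ (X : 𝒜) (a : M ⟶ X) (b : X ⟶ H), IsSES a b → SESSplits a b)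
    (hd : ∀ (X : 𝒜) (a : M ⟶ X) (b : X ⟶ M), IsSES a b → SESSplits a b) :
    ∀ (X : 𝒜) (a : D ⟶ X) (b : X ⟶ M), IsSES a b → SESSplits a b := by
  intro X a b hX
  have := hD.mono
  have := hX.mono
  have hq := IsSES.cokernel (iD ≫ a)
  obtain ⟨j, g, hj, -, hY⟩ := hD.exists_quotient hX hq
  rcases ha _ j g hY with ⟨r, hr⟩ | ⟨⟨e⟩⟩
  · obtain ⟨k, hk⟩ := hD.exists_kernel hX (cokernel.π (iD ≫ a) ≫ r) (by
      rw [← Category.assoc, ← hj, Category.assoc, hr, Category.comp_id])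
    obtain ⟨s, hs⟩ := hk.splits_iff_exists_section.1 (hd _ _ _ hk)
    exact hX.splits_iff_exists_section.2 ⟨s ≫ kernel.ι _, by rw [Category.assoc, hs]⟩
  · obtain ⟨r, hr⟩ := hc _ _ _ (hq.comp_iso e)
    exact absurd ⟨a ≫ r, by rw [← Category.assoc, hr]⟩ hDns
end

section
/- Let 𝒜 be an abelian category, M and J simple objects of 𝒜 with M not isomorphic to J, and let 0 → J → H → M → 0 and 0 → M → D → J → 0 be non-split short exact sequences. Assume: (a) every short exact sequence 0 → J → Y → M → 0 either splits or has Y ≅ H; (b) every short exact sequence 0 → M → Y → J → 0 either splits or has Y ≅ D; (c) every short exact sequence 0 → H → X → J → 0 splits; and (d) every short exact sequence 0 → J → X → J → 0 splits. Then every short exact sequence 0 → J → X → D → 0 splits. -/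
open CategoryTheory CategoryTheory.Limits

/-- A retraction of the monomorphism of a short exact sequence yields a section of the
epimorphism. -/
theorem SESSplits.exists_section {𝒜 : Type u} [Category.{v} 𝒜] [Abelian 𝒜] {A X B : 𝒜}
    {i : A ⟶ X} {p : X ⟶ B} (h : IsSES i p) (hs : SESSplits i p) :
    ∃ s : B ⟶ X, s ≫ p = 𝟙 B := by
  obtain ⟨w, hS⟩ := h
  obtain ⟨r, hr⟩ := hs
  have := hS.epi_g
  exact ⟨_, (ShortComplex.Splitting.ofExactOfRetraction _ hS.exact r hr this).s_g⟩

/-- A section of the epimorphism of a short exact sequence yields a retraction of the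
monomorphism. -/
theorem SESSplits.of_section {𝒜 : Type u} [Category.{v} 𝒜] [Abelian 𝒜] {A X B : 𝒜}
    {i : A ⟶ X} {p : X ⟶ B} (h : IsSES i p) {s : B ⟶ X} (hs : s ≫ p = 𝟙 B) :
    SESSplits i p := by
  obtain ⟨w, hS⟩ := h
  have := hS.mono_f
  exact ⟨_, (ShortComplex.Splitting.ofExactOfSection _ hS.exact s hs this).f_r⟩

/-- Precomposing the monomorphism of a short exact sequence with an isomorphism. -/
theorem IsSES.iso_comp {𝒜 : Type u} [Category.{v} 𝒜] [Abelian 𝒜] {A A' X B : 𝒜}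
    {i : A ⟶ X} {p : X ⟶ B} (h : IsSES i p) (e : A' ≅ A) : IsSES (e.hom ≫ i) p := by
  obtain ⟨w, hS⟩ := h
  refine ⟨by simp [w], ?_⟩
  let φ : ShortComplex.mk i p w ≅ ShortComplex.mk (e.hom ≫ i) p (by simp [w]) :=
    ShortComplex.isoMk e.symm (Iso.refl _) (Iso.refl _) (by simp) (by simp)
  exact ShortComplex.shortExact_of_iso φ hS

/-- The pullback of a short exact sequence along a morphism. -/
theorem IsSES.pullback_snd {𝒜 : Type u} [Category.{v} 𝒜] [Abelian 𝒜] {A X B C : 𝒜}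
    {a : A ⟶ X} {b : X ⟶ B} (h : IsSES a b) (f : C ⟶ B) :
    IsSES (pullback.lift a 0 (by simp [h.choose]) : A ⟶ pullback b f) (pullback.snd b f) := by
  obtain ⟨w, hS⟩ := h
  have := hS.mono_f
  have := hS.epi_g
  dsimp only at *
  refine ⟨pullback.lift_snd _ _ _, ?_⟩
  have : Mono (pullback.lift a 0 (by simp [w]) : A ⟶ pullback b f) :=
    mono_of_mono_fac (pullback.lift_fst a 0 _)
  refine ShortComplex.ShortExact.mk' ?_ this inferInstance
  rw [ShortComplex.exact_iff_exact_up_to_refinements]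
  intro T x hx
  dsimp at x hx
  have hb : (x ≫ pullback.fst b f) ≫ b = 0 := by
    rw [Category.assoc, pullback.condition, reassoc_of% hx, zero_comp]
  obtain ⟨l, hl⟩ : ∃ l : T ⟶ A, l ≫ a = x ≫ pullback.fst b f :=
    ⟨hS.exact.lift _ hb, hS.exact.lift_f _ hb⟩
  have hlx : x = l ≫ pullback.lift a 0 (by simp [w]) := by
    apply pullback.hom_ext
    · rw [Category.assoc, pullback.lift_fst, hl]
    · rw [Category.assoc, pullback.lift_snd, hx, comp_zero]
  exact ⟨T, 𝟙 T, inferInstance, l, (Category.id_comp x).trans hlx⟩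

/-- The preimage in `X` of the subobject `M` of the quotient `D` of `X` is the kernel of the
composite `X ⟶ D ⟶ J`. -/
theorem IsSES.pullback_fst {𝒜 : Type u} [Category.{v} 𝒜] [Abelian 𝒜] {X M D J : 𝒜}
    {i : M ⟶ D} {p : D ⟶ J} (h : IsSES i p) (b : X ⟶ D) [Epi b] :
    IsSES (pullback.fst b i) (b ≫ p) := by
  obtain ⟨w, hS⟩ := h
  have := hS.mono_f
  have := hS.epi_g
  dsimp at *
  refine ⟨by simp [pullback.condition_assoc, w], ?_⟩
  refine ShortComplex.ShortExact.mk' ?_ (by dsimp; infer_instance) (by dsimp; infer_instance)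
  rw [ShortComplex.exact_iff_exact_up_to_refinements]
  intro T x hx
  dsimp at x hx
  have hb : (x ≫ b) ≫ p = 0 := by simpa using hx
  obtain ⟨l, hl⟩ : ∃ l : T ⟶ M, l ≫ i = x ≫ b :=
    ⟨hS.exact.lift _ hb, hS.exact.lift_f _ hb⟩
  exact ⟨T, 𝟙 T, inferInstance, pullback.lift x l hl.symm,
    (Category.id_comp x).trans (pullback.lift_fst x l hl.symm).symm⟩

/-- If the subobject `M` of `D` lifts to a subobject of the extension `X` of `D` by `A`, then
the quotient of `X` by it is an extension of `D / M` by `A`. -/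
theorem IsSES.cokernel_of_lift_s11 {𝒜 : Type u} [Category.{v} 𝒜] [Abelian 𝒜] {A X M D J : 𝒜}
    {a : A ⟶ X} {b : X ⟶ D} (h : IsSES a b) {i : M ⟶ D} {p : D ⟶ J} (h' : IsSES i p)
    {m : M ⟶ X} (hm : m ≫ b = i) :
    IsSES (a ≫ cokernel.π m)
      (cokernel.desc m (b ≫ p) (by rw [reassoc_of% hm, h'.choose])) := by
  obtain ⟨w, hS⟩ := h
  obtain ⟨w', hS'⟩ := h'
  have := hS.mono_f
  have := hS.epi_g
  have := hS'.mono_f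
  have := hS'.epi_g
  dsimp at *
  have : Mono m := by
    have : Mono (m ≫ b) := by rwa [hm]
    exact mono_of_mono m b
  have hw : m ≫ b ≫ p = 0 := by rw [reassoc_of% hm, w']
  have : Epi (cokernel.desc m (b ≫ p) hw) :=
    epi_of_epi_fac (cokernel.π_desc m (b ≫ p) hw)
  have hM : Mono (a ≫ cokernel.π m) := by
    refine Preadditive.mono_of_cancel_zero _ fun {T} f hf => ?_
    have hk : (f ≫ a) ≫ cokernel.π m = 0 := by simpa using hf
    have hg := Abelian.monoLift_comp m (f ≫ a) hk
    have hz : Abelian.monoLift m (f ≫ a) hk = 0 := by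
      rw [← cancel_mono i, ← hm, reassoc_of% hg, w, comp_zero, zero_comp]
    rw [← cancel_mono a, ← hg, hz, zero_comp, zero_comp]
  refine ⟨by simp [reassoc_of% w], ShortComplex.ShortExact.mk' ?_ hM this⟩
  rw [ShortComplex.exact_iff_exact_up_to_refinements]
  intro T y hy
  dsimp at y hy
  obtain ⟨T', π, hπ, x, hx⟩ := surjective_up_to_refinements_of_epi (cokernel.π m) y
  have hb : (x ≫ b) ≫ p = 0 := by
    rw [Category.assoc, ← cokernel.π_desc m (b ≫ p) hw, ← reassoc_of% hx, hy, comp_zero]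
  let g := hS'.exact.lift _ hb
  have hg : g ≫ i = x ≫ b := hS'.exact.lift_f _ hb
  have hz : (x - g ≫ m) ≫ b = 0 := by simp [hm, hg]
  refine ⟨T', π, hπ, hS.exact.lift _ hz, ?_⟩
  have hl : hS.exact.lift _ hz ≫ a = x - g ≫ m := hS.exact.lift_f _ hz
  dsimp
  rw [reassoc_of% hl, hx]
  simp

/-- Let `𝒜` be an abelian category, `M` and `J` non-isomorphic simple
objects, `0 → J → H → M → 0` and `0 → M → D → J → 0` non-split short exact sequences.
Assume: (a) every extension of `M` by `J` splits or has middle term `≅ H`; (b) every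
extension of `J` by `M` splits or has middle term `≅ D`; (c) every sequence
`0 → H → X → J → 0` splits; (d) every sequence `0 → J → X → J → 0` splits. Then every
short exact sequence `0 → J → X → D → 0` splits. -/
theorem ext_D_J_vanishes
    {𝒜 : Type u} [Category.{v} 𝒜] [Abelian 𝒜]
    {M J : 𝒜} [Simple M] [Simple J] (hMJ : IsEmpty (M ≅ J))
    {H : 𝒜} (iH : J ⟶ H) (pH : H ⟶ M) (hH : IsSES iH pH) (hHns : ¬ SESSplits iH pH)
    {D : 𝒜} (iD : M ⟶ D) (pD : D ⟶ J) (hD : IsSES iD pD) (hDns : ¬ SESSplits iD pD)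
    (ha : ∀ (Y : 𝒜) (j : J ⟶ Y) (q : Y ⟶ M), IsSES j q →
      SESSplits j q ∨ Nonempty (Y ≅ H))
    (hb : ∀ (Y : 𝒜) (j : M ⟶ Y) (q : Y ⟶ J), IsSES j q →
      SESSplits j q ∨ Nonempty (Y ≅ D))
    (hc : ∀ (X : 𝒜) (a : H ⟶ X) (b : X ⟶ J), IsSES a b → SESSplits a b)
    (hd : ∀ (X : 𝒜) (a : J ⟶ X) (b : X ⟶ J), IsSES a b → SESSplits a b) :
    ∀ (X : 𝒜) (a : J ⟶ X) (b : X ⟶ D), IsSES a b → SESSplits a b := by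
  intro X a b hX
  have : Epi b := hX.choose_spec.epi_g
  have hK := hX.pullback_snd iD
  have hKX := hD.pullback_fst b
  rcases ha _ _ _ hK with hs | ⟨⟨e⟩⟩
  · obtain ⟨s, hs⟩ := hs.exists_section hK
    have hm : (s ≫ pullback.fst b iD) ≫ b = iD := by
      rw [Category.assoc, pullback.condition, reassoc_of% hs]
    obtain ⟨r, hr⟩ := hd _ _ _ (hX.cokernel_of_lift_s11 hD hm)
    exact ⟨cokernel.π _ ≫ r, by simpa using hr⟩
  · have hHX := hKX.iso_comp e.symm
    obtain ⟨s, hs⟩ := (hc _ _ _ hHX).exists_section hHX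
    exact absurd (SESSplits.of_section hD (s := s ≫ b) (by simpa using hs)) hDns
end

section
/- Let 𝒜 be a ℂ-linear abelian category with finite-dimensional Hom spaces, M and J simple objects with M not isomorphic to J. Assume Ext¹(J, J) = 0, assume the ℂ-vector space Ext¹(J, M) is one-dimensional, and let 0 → M → D → J → 0 be a non-split short exact sequence. Then every short exact sequence 0 → D → X → J → 0 splits. -/
open CategoryTheory CategoryTheory.Limits

namespace IsSES

variable {𝒜 : Type u} [Category.{v} 𝒜] [Abelian 𝒜]

/-- The pushout of a short exact sequence along a morphism out of its first term. -/
lemma pushout {A X B A' : 𝒜} {i : A ⟶ X} {p : X ⟶ B} (h : IsSES i p) (f : A ⟶ A') :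
    IsSES (pushout.inr i f) (pushout.desc p 0 (by simp [h.choose])) := by
  obtain ⟨w, hS⟩ := h
  have : Mono i := hS.mono_f
  have : Epi p := hS.epi_g
  have hq : Epi (pushout.desc p 0 (by simp [w]) : Limits.pushout i f ⟶ B) :=
    epi_of_epi_fac (pushout.inl_desc _ _ _)
  refine ⟨pushout.inr_desc _ _ _, ?_⟩
  refine { exact := ?_, mono_f := inferInstanceAs (Mono (pushout.inr i f)), epi_g := hq }
  refine ShortComplex.exact_of_g_is_cokernel _ (CokernelCofork.IsColimit.ofπ' _ _ fun {Z} k hk ↦ ?_)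
  have hk' : pushout.inr i f ≫ k = 0 := hk
  have hi : i ≫ pushout.inl i f ≫ k = 0 := by
    rw [pushout.condition_assoc, hk', comp_zero]
  refine ⟨hS.exact.desc (pushout.inl i f ≫ k) hi, ?_⟩
  apply pushout.hom_ext
  · exact (pushout.inl_desc_assoc _ _ _ _).trans (hS.exact.g_desc _ hi)
  · exact (pushout.inr_desc_assoc _ _ _ _).trans (zero_comp.trans hk'.symm)

/-- If `t : X ⟶ C` extends `p'` along `i`, then `X` restricts to an extension of `B` by `ker p'`
with total space `ker t`. -/
lemma kernel_of_extension {A X B K C : 𝒜} {i : A ⟶ X} {p : X ⟶ B} (h : IsSES i p)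
    {i' : K ⟶ A} {p' : A ⟶ C} (h' : IsSES i' p') (t : X ⟶ C) (ht : i ≫ t = p') :
    IsSES (kernel.lift t (i' ≫ i) (by rw [Category.assoc, ht, h'.choose])) (kernel.ι t ≫ p) := by
  obtain ⟨w, hS⟩ := h
  obtain ⟨w', hS'⟩ := h'
  have : Mono i := hS.mono_f
  have : Epi p := hS.epi_g
  have : Mono i' := hS'.mono_f
  have : Epi p' := hS'.epi_g
  have : Epi t := epi_of_epi_fac ht
  have hj : Mono (kernel.lift t (i' ≫ i) (by rw [Category.assoc, ht, w'])) :=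
    mono_of_mono_fac (kernel.lift_ι t (i' ≫ i) _)
  refine ⟨by simp [w], ?_⟩
  refine { exact := ?_, mono_f := hj, epi_g := ?_ }
  · refine ShortComplex.exact_of_f_is_kernel _ (KernelFork.IsLimit.ofι' _ _ fun {Z} k hk ↦ ?_)
    have hk' : (k ≫ kernel.ι t) ≫ p = 0 := by simpa using hk
    obtain ⟨l, hl⟩ : {l // l ≫ i = k ≫ kernel.ι t} :=
      ⟨hS.exact.lift _ hk', hS.exact.lift_f _ hk'⟩
    have hl' : l ≫ p' = 0 := by
      rw [← ht, reassoc_of% hl, kernel.condition, comp_zero]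
    have hm : hS'.exact.lift l hl' ≫ i' = l := hS'.exact.lift_f _ hl'
    refine ⟨hS'.exact.lift _ hl', ?_⟩
    rw [← cancel_mono (kernel.ι t), ← hl]
    simp [reassoc_of% hm]
  · refine Preadditive.epi_of_cancel_zero _ fun {Z} g hg ↦ ?_
    have hg' : kernel.ι t ≫ p ≫ g = 0 := by simpa using hg
    have hT : (ShortComplex.mk (kernel.ι t) t (kernel.condition t)).Exact :=
      ShortComplex.exact_kernel t
    have hu : t ≫ hT.desc (p ≫ g) hg' = p ≫ g := hT.g_desc _ hg'
    have hu0 : hT.desc (p ≫ g) hg' = 0 := by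
      rw [← cancel_epi p', ← ht, Category.assoc, hu, reassoc_of% w, zero_comp, comp_zero]
    rw [← cancel_epi p, ← hu, hu0, comp_zero, comp_zero]

/-- In a morphism of short exact sequences that is the identity on the quotients, the left
square is a pushout: it suffices to extend from the two smaller objects. -/
lemma exists_desc_s13 {A X A' X' B Z : 𝒜} {i : A ⟶ X} {p : X ⟶ B} (h : IsSES i p)
    {i' : A' ⟶ X'} {p' : X' ⟶ B} (h' : IsSES i' p') {f : A ⟶ A'} {g : X ⟶ X'}
    (hfg : i ≫ g = f ≫ i') (hg : g ≫ p' = p) (x : X ⟶ Z) (y : A' ⟶ Z) (hxy : i ≫ x = f ≫ y) :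
    ∃ r : X' ⟶ Z, i' ≫ r = y ∧ g ≫ r = x := by
  obtain ⟨w, hS⟩ := h.pushout f
  obtain ⟨w', hS'⟩ := h'
  let φ : ShortComplex.mk _ _ w ⟶ ShortComplex.mk _ _ w' :=
    { τ₁ := 𝟙 A'
      τ₂ := pushout.desc g i' hfg
      τ₃ := 𝟙 B
      comm₁₂ := by simp [pushout.inr_desc]
      comm₂₃ := by
        apply pushout.hom_ext
        · simp [pushout.inl_desc_assoc, pushout.inl_desc, hg]
        · simp [pushout.inr_desc_assoc, pushout.inr_desc, w'] }
  have : IsIso φ.τ₁ := inferInstanceAs (IsIso (𝟙 A'))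
  have : IsIso φ.τ₃ := inferInstanceAs (IsIso (𝟙 B))
  have : IsIso (pushout.desc g i' hfg) :=
    ShortComplex.isIso₂_of_shortExact_of_isIso₁₃ φ hS hS'
  obtain ⟨r, hr⟩ : ∃ r, pushout.desc g i' hfg ≫ r = pushout.desc x y hxy :=
    ⟨inv (pushout.desc g i' hfg) ≫ pushout.desc x y hxy, IsIso.hom_inv_id_assoc _ _⟩
  refine ⟨r, ?_, ?_⟩
  · rw [← pushout.inr_desc g i' hfg, Category.assoc, hr, pushout.inr_desc]
  · rw [← pushout.inl_desc g i' hfg, Category.assoc, hr, pushout.inl_desc]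

end IsSES

/-- Let `𝒜` be a `ℂ`-linear abelian category with finite-dimensional Hom
spaces, `M` and `J` non-isomorphic simple objects. Assume `Ext¹(J, J) = 0`, assume
`Ext¹(J, M)` is one-dimensional, and let `0 → M → D → J → 0` be a non-split short exact
sequence. Then every short exact sequence `0 → D → X → J → 0` splits. -/
theorem ext_J_D_vanishes
    {𝒜 : Type u} [Category.{v} 𝒜] [Abelian 𝒜] [Linear ℂ 𝒜]
    [∀ X Y : 𝒜, FiniteDimensional ℂ (X ⟶ Y)]
    {M J : 𝒜} [Simple M] [Simple J] (hMJ : IsEmpty (M ≅ J))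
    (hExtJJ : ∀ (X : 𝒜) (a : J ⟶ X) (b : X ⟶ J), IsSES a b → SESSplits a b)
    {D : 𝒜} (iD : M ⟶ D) (pD : D ⟶ J) (hD : IsSES iD pD) (hDns : ¬ SESSplits iD pD)
    (hExtJM : ∀ (Y : 𝒜) (j : M ⟶ Y) (q : Y ⟶ J), IsSES j q →
      SESSplits j q ∨
        ∃ c : ℂ, c ≠ 0 ∧ ∃ ψ : Y ⟶ D, j ≫ ψ = iD ∧ ψ ≫ pD = q ≫ (c • 𝟙 J)) :
    ∀ (X : 𝒜) (a : D ⟶ X) (b : X ⟶ J), IsSES a b → SESSplits a b := by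
  intro X a b h
  obtain ⟨s, hs⟩ := hExtJJ _ _ _ (h.pushout pD)
  have ht : a ≫ pushout.inl a pD ≫ s = pD := by
    rw [pushout.condition_assoc, hs, Category.comp_id]
  have hE := h.kernel_of_extension hD _ ht
  obtain ⟨ψ, hψ⟩ : ∃ ψ, kernel.lift _ (iD ≫ a) (by rw [Category.assoc, ht, hD.choose]) ≫ ψ = iD := by
    rcases hExtJM _ _ _ hE with ⟨ρ, hρ⟩ | ⟨-, -, ψ, hψ, -⟩
    · exact ⟨ρ ≫ iD, by rw [reassoc_of% hρ]⟩
    · exact ⟨ψ, hψ⟩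
  obtain ⟨r, hr, -⟩ := hE.exists_desc_s13 h (kernel.lift_ι _ _ _) rfl ψ (𝟙 D) (by simpa using hψ)
  exact ⟨r, hr⟩
end

section
/- Let 𝒜 be a ℂ-linear abelian category with finite-dimensional Hom spaces in which every object has finite length, and suppose every simple object of 𝒜 is isomorphic to one of two fixed non-isomorphic simple objects M and J. Assume: Ext¹(M, M) = 0 and Ext¹(J, J) = 0; the ℂ-vector spaces Ext¹(M, J) and Ext¹(J, M) are each one-dimensional; let H be the middle term of a non-split short exact sequence 0 → J → H → M → 0 and D the middle term of a non-split short exact sequence 0 → M → D → J → 0; and assume Ext¹(H, M) = 0, Ext¹(M, H) = 0, Ext¹(H, J) = 0 and Ext¹(J, H) = 0. Then every indecomposable object of 𝒜 is isomorphic to M, J, H, or D. -/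
open CategoryTheory CategoryTheory.Limits

/-- An object of an abelian category has finite length if it admits a finite filtration with
simple subquotients: inductively, it is either zero, or an extension of a finite length
object by a simple object. -/
inductive ObjIsFiniteLength {𝒜 : Type u} [Category.{v} 𝒜] [Abelian 𝒜] : 𝒜 → Prop
  | of_isZero (X : 𝒜) : IsZero X → ObjIsFiniteLength X
  | of_ses {S X Y : 𝒜} (f : S ⟶ X) (g : X ⟶ Y) :
      Simple S → IsSES f g → ObjIsFiniteLength Y → ObjIsFiniteLength X

section ShortExactSequences

variable {𝒜 : Type u} [Category.{v} 𝒜] [Abelian 𝒜]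

namespace IsSES

variable {A X B : 𝒜} {i : A ⟶ X} {p : X ⟶ B}

lemma zero (h : IsSES i p) : i ≫ p = 0 := h.1

lemma mono_s14 (h : IsSES i p) : Mono i := h.2.mono_f

lemma epi_s14 (h : IsSES i p) : Epi p := h.2.epi_g

lemma exists_lift_s14 (h : IsSES i p) {W : 𝒜} (z : W ⟶ X) (hz : z ≫ p = 0) :
    ∃ w : W ⟶ A, w ≫ i = z := by
  have := h.mono_s14
  exact ⟨h.2.exact.lift z hz, h.2.exact.lift_f z hz⟩

lemma exists_desc_s14 (h : IsSES i p) {W : 𝒜} (z : X ⟶ W) (hz : i ≫ z = 0) :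
    ∃ w : B ⟶ W, p ≫ w = z := by
  have := h.epi_s14
  exact ⟨h.2.exact.desc z hz, h.2.exact.g_desc z hz⟩

lemma of_lift [Mono i] [Epi p] (w : i ≫ p = 0)
    (h : ∀ (W : 𝒜) (z : W ⟶ X), z ≫ p = 0 → ∃ y : W ⟶ A, y ≫ i = z) : IsSES i p := by
  choose l hl using h
  exact ⟨w, { exact := ShortComplex.exact_of_f_is_kernel _ (KernelFork.IsLimit.ofι' _ _
    fun z hz ↦ ⟨l _ z hz, hl _ z hz⟩) }⟩

lemma of_desc [Mono i] [Epi p] (w : i ≫ p = 0)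
    (h : ∀ (W : 𝒜) (z : X ⟶ W), i ≫ z = 0 → ∃ y : B ⟶ W, p ≫ y = z) : IsSES i p := by
  choose l hl using h
  exact ⟨w, { exact := ShortComplex.exact_of_g_is_cokernel _ (CokernelCofork.IsColimit.ofπ' _ _
    fun z hz ↦ ⟨l _ z hz, hl _ z hz⟩) }⟩

lemma of_mono (i : A ⟶ X) [Mono i] : IsSES i (cokernel.π i) :=
  of_desc (cokernel.condition i) fun _ z hz ↦ ⟨cokernel.desc i z hz, cokernel.π_desc i z hz⟩

lemma of_epi (p : X ⟶ B) [Epi p] : IsSES (kernel.ι p) p :=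
  of_lift (kernel.condition p) fun _ z hz ↦ ⟨kernel.lift p z hz, kernel.lift_ι p z hz⟩

lemma iso_left (h : IsSES i p) {A' : 𝒜} (e : A' ≅ A) : IsSES (e.hom ≫ i) p := by
  have := h.mono_s14
  have := h.epi_s14
  refine of_lift (by simp [h.zero]) fun W z hz ↦ ?_
  obtain ⟨w, hw⟩ := h.exists_lift_s14 z hz
  exact ⟨w ≫ e.inv, by simp [hw]⟩

lemma iso_right (h : IsSES i p) {B' : 𝒜} (e : B ≅ B') : IsSES i (p ≫ e.hom) := by
  have := h.mono_s14
  have := h.epi_s14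
  refine of_desc (by simp [reassoc_of% h.zero]) fun W z hz ↦ ?_
  obtain ⟨w, hw⟩ := h.exists_desc_s14 z hz
  exact ⟨e.inv ≫ w, by simp [hw]⟩

lemma exists_section (h : IsSES i p) (hs : SESSplits i p) : ∃ s : B ⟶ X, s ≫ p = 𝟙 B := by
  have := h.epi_s14
  obtain ⟨r, hr⟩ := hs
  obtain ⟨s, hs⟩ := h.exists_desc_s14 (𝟙 X - r ≫ i) (by simp [reassoc_of% hr])
  refine ⟨s, ?_⟩
  rw [← cancel_epi p, reassoc_of% hs]
  simp [h.zero]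

lemma splits_of_section (h : IsSES i p) (s : B ⟶ X) (hs : s ≫ p = 𝟙 B) : SESSplits i p := by
  have := h.mono_s14
  obtain ⟨r, hr⟩ := h.exists_lift_s14 (𝟙 X - p ≫ s) (by simp [hs])
  refine ⟨r, ?_⟩
  rw [← cancel_mono i, Category.assoc, hr]
  simp [reassoc_of% h.zero]

/-- The pullback of a short exact sequence along a morphism to its last term. -/
lemma exists_pullback (h : IsSES i p) {C : 𝒜} (f : C ⟶ B) :
    ∃ j : A ⟶ pullback p f, j ≫ pullback.fst p f = i ∧ IsSES j (pullback.snd p f) := by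
  have := h.mono_s14
  have := h.epi_s14
  obtain ⟨j, hj, hj'⟩ := pullback.lift' (f := p) (g := f) i 0 (by simp [h.zero])
  have : Mono j := mono_of_mono_fac hj
  refine ⟨j, hj, of_lift hj' fun W z hz ↦ ?_⟩
  obtain ⟨w, hw⟩ := h.exists_lift_s14 (z ≫ pullback.fst p f)
    (by rw [Category.assoc, pullback.condition, reassoc_of% hz, zero_comp])
  exact ⟨w, pullback.hom_ext (by simp [hj, hw]) (by simp [hj', hz])⟩

/-- A morphism to the last term of a short exact sequence lifts to the middle term as soon as
the pulled back extension splits. -/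
lemma exists_lift_of_pullback (h : IsSES i p) {C : 𝒜} (f : C ⟶ B)
    (hs : ∀ j : A ⟶ pullback p f, IsSES j (pullback.snd p f) →
      SESSplits j (pullback.snd p f)) :
    ∃ t : C ⟶ X, t ≫ p = f := by
  obtain ⟨j, -, hj⟩ := h.exists_pullback f
  obtain ⟨s, hs⟩ := hj.exists_section (hs j hj)
  exact ⟨s ≫ pullback.fst p f, by rw [Category.assoc, pullback.condition, reassoc_of% hs]⟩

/-- The quotient of an extension of `P` by `K` by a subobject `S` of `K` is an extension of `P`
by `K / S`. -/
lemma exists_quotient_s14 (h : IsSES i p) {S Y : 𝒜} {f : S ⟶ A} {g : A ⟶ Y} (hfg : IsSES f g) :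
    ∃ (X' : 𝒜) (q : X ⟶ X') (i' : Y ⟶ X') (p' : X' ⟶ B),
      IsSES (f ≫ i) q ∧ IsSES i' p' ∧ g ≫ i' = i ≫ q ∧ q ≫ p' = p := by
  have := h.mono_s14
  have := h.epi_s14
  have := hfg.mono_s14
  have := hfg.epi_s14
  have hq := of_mono (f ≫ i)
  set q := cokernel.π (f ≫ i)
  obtain ⟨i', hi'⟩ := hfg.exists_desc_s14 (i ≫ q) (by rw [← Category.assoc, hq.zero])
  obtain ⟨p', hp'⟩ := hq.exists_desc_s14 p (by simp [h.zero])
  have : Epi p' := epi_of_epi_fac hp'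
  have : Mono i' := by
    refine Preadditive.mono_of_cancel_zero _ fun {W} z hz ↦ ?_
    have h1 : (pullback.fst g z ≫ i) ≫ q = 0 := by
      rw [Category.assoc, ← hi', pullback.condition_assoc, hz, comp_zero]
    obtain ⟨w, hw⟩ := hq.exists_lift_s14 _ h1
    have h2 : w ≫ f = pullback.fst g z := by
      rw [← cancel_mono i, Category.assoc, hw]
    rw [← cancel_epi (pullback.snd g z), ← pullback.condition, ← h2]
    simp [hfg.zero]
  refine ⟨_, q, i', p', hq, of_desc ?_ fun W z hz ↦ ?_, hi', hp'⟩
  · rw [← cancel_epi g, reassoc_of% hi', hp', h.zero, comp_zero]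
  · obtain ⟨y, hy⟩ := h.exists_desc_s14 (q ≫ z) (by rw [← reassoc_of% hi', hz, comp_zero])
    exact ⟨y, by rw [← cancel_epi q, reassoc_of% hp', hy]⟩

/-- If a subobject of the last term of an extension of `B` by `A` lifts to the middle term, then
the quotient of the extension by this lift is an extension of the quotient by `A`. -/
lemma cokernel_lift (h : IsSES i p) {S Y X' : 𝒜} {f : S ⟶ B} {g : B ⟶ Y} (hfg : IsSES f g)
    {t : S ⟶ X} (ht : t ≫ p = f) {q : X ⟶ X'} (hq : IsSES t q) :
    ∃ p' : X' ⟶ Y, IsSES (i ≫ q) p' ∧ q ≫ p' = p ≫ g := by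
  have := h.mono_s14
  have := h.epi_s14
  have := hfg.mono_s14
  have := hfg.epi_s14
  have := hq.epi_s14
  obtain ⟨p', hp'⟩ := hq.exists_desc_s14 (p ≫ g) (by rw [reassoc_of% ht, hfg.zero])
  have : Epi p' := epi_of_epi_fac hp'
  have : Mono (i ≫ q) := by
    refine Preadditive.mono_of_cancel_zero _ fun {W} z hz ↦ ?_
    obtain ⟨w, hw⟩ := hq.exists_lift_s14 (z ≫ i) (by simpa using hz)
    have hw0 : w = 0 := by
      rw [← cancel_mono f, ← ht, reassoc_of% hw, h.zero, comp_zero, zero_comp]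
    rw [← cancel_mono i, ← hw, hw0, zero_comp, zero_comp]
  refine ⟨p', of_desc ?_ fun W z hz ↦ ?_, hp'⟩
  · rw [Category.assoc, hp', reassoc_of% h.zero, zero_comp]
  · obtain ⟨y, hy⟩ := h.exists_desc_s14 (q ≫ z) (by simpa using hz)
    obtain ⟨y', hy'⟩ := hfg.exists_desc_s14 y (by
      rw [← ht, Category.assoc, hy, reassoc_of% hq.zero, zero_comp])
    exact ⟨y', by rw [← cancel_epi q, reassoc_of% hp', hy', hy]⟩

/-- A morphism of extensions which is an isomorphism on both ends is an isomorphism. -/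
lemma isIso_middle (h : IsSES i p) {X' B' : 𝒜} {i' : A ⟶ X'} {p' : X' ⟶ B'} (h' : IsSES i' p')
    {ψ : X ⟶ X'} {e : B ⟶ B'} [IsIso e] (hi : i ≫ ψ = i') (hp : ψ ≫ p' = p ≫ e) :
    IsIso ψ := by
  have := h.epi_s14
  have := h'.mono_s14
  have : Mono ψ := by
    refine Preadditive.mono_of_cancel_zero _ fun {W} z hz ↦ ?_
    obtain ⟨w, hw⟩ := h.exists_lift_s14 z (by
      rw [← cancel_mono e, Category.assoc, ← hp, reassoc_of% hz, zero_comp, zero_comp])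
    have hw0 : w = 0 := by rw [← cancel_mono i', ← hi, reassoc_of% hw, hz, zero_comp]
    rw [← hw, hw0, zero_comp]
  have : Epi ψ := by
    refine Preadditive.epi_of_cancel_zero _ fun {W} z hz ↦ ?_
    obtain ⟨y, hy⟩ := h'.exists_desc_s14 z (by rw [← hi, Category.assoc, hz, comp_zero])
    have hy0 : y = 0 := by
      rw [← cancel_epi (p ≫ e), ← hp, Category.assoc, hy, hz, comp_zero]
    rw [← hy, hy0, comp_zero]
  exact isIso_of_mono_of_epi ψ

end IsSES

lemma exists_simple_subobject {X : 𝒜} (hX : ObjIsFiniteLength X) (h0 : ¬ IsZero X) :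
    ∃ (S : 𝒜) (f : S ⟶ X), Simple S ∧ Mono f := by
  cases hX with
  | of_isZero _ h => exact absurd h h0
  | of_ses f g hS hfg _ => exact ⟨_, f, hS, hfg.mono_s14⟩

/-- An object `I` is injective relative to a class of objects closed under subobjects and
quotients by simple subobjects if all extensions of simple objects by `I` in this class split. -/
lemma splits_of_splits_simple {I : 𝒜} (P : 𝒜 → Prop)
    (hsub : ∀ {X Y : 𝒜} (f : X ⟶ Y), Mono f → P Y → P X)
    (hquot : ∀ {S X Y : 𝒜} (f : S ⟶ X) (g : X ⟶ Y), Simple S → IsSES f g → P X → P Y)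
    (hsimple : ∀ {S X : 𝒜} (a : I ⟶ X) (b : X ⟶ S), Simple S → P X → IsSES a b →
      SESSplits a b)
    {Q : 𝒜} (hQ : ObjIsFiniteLength Q) :
    ∀ {X : 𝒜} (a : I ⟶ X) (b : X ⟶ Q), P X → IsSES a b → SESSplits a b := by
  induction hQ with
  | of_isZero Q hQ =>
    intro X a b _ h
    exact h.splits_of_section 0 (hQ.eq_of_src _ _)
  | of_ses f g hS hfg _ ih =>
    intro X a b hX h
    have := hfg.mono_s14
    obtain ⟨t, ht⟩ := h.exists_lift_of_pullback f fun j hj ↦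
      hsimple _ _ hS (hsub (pullback.fst b f) inferInstance hX) hj
    have : Mono t := mono_of_mono_fac ht
    have hq := IsSES.of_mono t
    obtain ⟨p', hp', -⟩ := h.cokernel_lift hfg ht hq
    obtain ⟨r, hr⟩ := ih _ _ (hquot _ _ hS hq hX) hp'
    exact ⟨cokernel.π t ≫ r, by rw [← hr, Category.assoc]⟩

/-- All extensions of `P` by objects of finite length split if those by simple objects do. -/
lemma splits_of_simple_splits {P : 𝒜}
    (hsimple : ∀ {S X : 𝒜} (a : S ⟶ X) (b : X ⟶ P), Simple S → IsSES a b → SESSplits a b)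
    {K : 𝒜} (hK : ObjIsFiniteLength K) :
    ∀ {X : 𝒜} (a : K ⟶ X) (b : X ⟶ P), IsSES a b → SESSplits a b := by
  induction hK with
  | of_isZero K hK =>
    intro X a b h
    exact ⟨0, hK.eq_of_src _ _⟩
  | of_ses f g hS hfg _ ih =>
    intro X a b h
    obtain ⟨X', q, i', p', hq, hi', -, hqp⟩ := h.exists_quotient_s14 hfg
    obtain ⟨s, hs⟩ := hi'.exists_section (ih _ _ hi')
    obtain ⟨t, ht⟩ := hq.exists_lift_of_pullback s fun j hj ↦ hsimple _ _ hS hj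
    exact h.splits_of_section t (by rw [← hqp, reassoc_of% ht, hs])

lemma sesSplits_of_iso_left {A A' X B : 𝒜} (e : A ≅ A')
    (hA' : ∀ (X : 𝒜) (a : A' ⟶ X) (b : X ⟶ B), IsSES a b → SESSplits a b)
    {a : A ⟶ X} {b : X ⟶ B} (h : IsSES a b) : SESSplits a b := by
  obtain ⟨r, hr⟩ := hA' _ _ _ (h.iso_left e.symm)
  exact ⟨r ≫ e.inv, by
    rw [← cancel_epi e.inv, ← Category.assoc a, ← Category.assoc, ← Category.assoc e.inv]
    simpa using hr =≫ e.inv⟩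

lemma CategoryTheory.Indecomposable.nonempty_iso_of_retract {X A : 𝒜} (hX : Indecomposable X)
    (hA : ¬ IsZero A) (i : A ⟶ X) (r : X ⟶ A) (hr : i ≫ r = 𝟙 A) : Nonempty (X ≅ A) := by
  have : Mono i := mono_of_mono_fac hr
  have hi := IsSES.of_mono i
  have hs := (ShortComplex.Splitting.ofExactOfRetraction _ hi.2.exact r hr hi.epi_s14)
  have e : X ≅ A ⊞ cokernel i := (hs.isoBinaryBiproduct :)
  have h0 : IsZero (cokernel i) := (hX.2 _ _ e).resolve_left hA
  have : Epi i := Preadditive.epi_of_isZero_cokernel i h0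
  have : IsIso i := isIso_of_mono_of_epi i
  exact ⟨(asIso i).symm⟩

section Linear

variable [Linear ℂ 𝒜]

lemma isIso_smul_id {c : ℂ} (hc : c ≠ 0) (X : 𝒜) : IsIso (c • 𝟙 X) :=
  ⟨c⁻¹ • 𝟙 X, by simp [smul_smul, hc], by simp [smul_smul, hc]⟩

variable {S T D : 𝒜} {i : S ⟶ D} {p : D ⟶ T}

/-- If `D` is an extension of `T` by `S` whose class spans `Ext¹(T, S)`, and `S` has no
self-extensions, then `Ext¹(D, S) = 0`. -/
lemma splits_of_spanning_extension_right (hD : IsSES i p)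
    (hSS : ∀ (X : 𝒜) (a : S ⟶ X) (b : X ⟶ S), IsSES a b → SESSplits a b)
    (hTS : ∀ (Y : 𝒜) (j : S ⟶ Y) (q : Y ⟶ T), IsSES j q →
      SESSplits j q ∨
        ∃ c : ℂ, c ≠ 0 ∧ ∃ ψ : Y ⟶ D, j ≫ ψ = i ∧ ψ ≫ p = q ≫ (c • 𝟙 T))
    {X : 𝒜} {a : S ⟶ X} {b : X ⟶ D} (h : IsSES a b) : SESSplits a b := by
  have := hD.mono_s14
  obtain ⟨t, ht⟩ := h.exists_lift_of_pullback i fun j hj ↦ hSS _ _ _ hj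
  have : Mono t := mono_of_mono_fac ht
  obtain ⟨p', hp', hqp⟩ := h.cokernel_lift hD ht (IsSES.of_mono t)
  obtain ⟨r, hr⟩ | ⟨c, -, ψ, hψi, hψp⟩ := hTS _ _ _ hp'
  · exact ⟨cokernel.π t ≫ r, by rw [← hr, Category.assoc]⟩
  · obtain ⟨ρ, hρ⟩ := hD.exists_lift_s14 (cokernel.π t ≫ ψ - c • b) (by
      simp [hψp, hqp])
    refine ⟨ρ, ?_⟩
    rw [← cancel_mono i, Category.assoc, hρ, Preadditive.comp_sub, ← Category.assoc, hψi,
      Linear.comp_smul, h.zero]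
    simp

/-- If `D` is an extension of `T` by `S` whose class spans `Ext¹(T, S)`, and `T` has no
self-extensions, then `Ext¹(T, D) = 0`. -/
lemma splits_of_spanning_extension_left (hD : IsSES i p)
    (hTT : ∀ (X : 𝒜) (a : T ⟶ X) (b : X ⟶ T), IsSES a b → SESSplits a b)
    (hTS : ∀ (Y : 𝒜) (j : S ⟶ Y) (q : Y ⟶ T), IsSES j q →
      SESSplits j q ∨
        ∃ c : ℂ, c ≠ 0 ∧ ∃ ψ : Y ⟶ D, j ≫ ψ = i ∧ ψ ≫ p = q ≫ (c • 𝟙 T))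
    {X : 𝒜} {a : D ⟶ X} {b : X ⟶ T} (h : IsSES a b) : SESSplits a b := by
  have := hD.epi_s14
  obtain ⟨X', q, i', p', hq, hi', -, hqp⟩ := h.exists_quotient_s14 hD
  obtain ⟨s, hs⟩ := hi'.exists_section (hTT _ _ _ hi')
  obtain ⟨j, hj, hjs⟩ := hq.exists_pullback s
  have hfst : pullback.fst q s ≫ b = pullback.snd q s := by
    rw [← hqp, pullback.condition_assoc, hs, Category.comp_id]
  obtain hsp | ⟨c, hc, ψ, hψi, hψp⟩ := hTS _ _ _ hjs
  · obtain ⟨σ, hσ⟩ := hjs.exists_section hsp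
    exact h.splits_of_section (σ ≫ pullback.fst q s) (by rw [Category.assoc, hfst, hσ])
  · have := isIso_smul_id hc T
    have := hjs.isIso_middle hD hψi hψp
    obtain ⟨y, hy⟩ := hD.exists_desc_s14 (inv ψ ≫ pullback.fst q s - a) (by
      simp [← hψi, hj])
    refine h.splits_of_section (c • y) ?_
    rw [← cancel_epi p, Linear.smul_comp, Linear.comp_smul, reassoc_of% hy,
      Preadditive.sub_comp, h.zero, Category.assoc, hfst, sub_zero, ← cancel_epi ψ]
    simp [hψp]

end Linear

end ShortExactSequences

/-- Let `𝒜` be a `ℂ`-linear abelian category with finite-dimensional Hom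
spaces in which every object has finite length, whose simple objects are, up to isomorphism,
exactly two non-isomorphic objects `M` and `J`. Assume `Ext¹(M,M) = 0 = Ext¹(J,J)`, that
`Ext¹(M,J)` and `Ext¹(J,M)` are each one-dimensional, spanned by the classes of non-split
extensions `0 → J → H → M → 0` and `0 → M → D → J → 0`, and that
`Ext¹(H,M) = Ext¹(M,H) = Ext¹(H,J) = Ext¹(J,H) = 0`. Then every indecomposable object of
`𝒜` is isomorphic to `M`, `J`, `H`, or `D`. -/
theorem indecomposable_HC_bimodules
    {𝒜 : Type u} [Category.{v} 𝒜] [Abelian 𝒜] [Linear ℂ 𝒜]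
    [∀ X Y : 𝒜, FiniteDimensional ℂ (X ⟶ Y)]
    (hlen : ∀ X : 𝒜, ObjIsFiniteLength X)
    {M J : 𝒜} [Simple M] [Simple J] (hMJ : IsEmpty (M ≅ J))
    (hsimples : ∀ S : 𝒜, Simple S → Nonempty (S ≅ M) ∨ Nonempty (S ≅ J))
    (hExtMM : ∀ (X : 𝒜) (a : M ⟶ X) (b : X ⟶ M), IsSES a b → SESSplits a b)
    (hExtJJ : ∀ (X : 𝒜) (a : J ⟶ X) (b : X ⟶ J), IsSES a b → SESSplits a b)
    {H : 𝒜} (iH : J ⟶ H) (pH : H ⟶ M) (hH : IsSES iH pH) (hHns : ¬ SESSplits iH pH)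
    {D : 𝒜} (iD : M ⟶ D) (pD : D ⟶ J) (hD : IsSES iD pD) (hDns : ¬ SESSplits iD pD)
    (hExtMJ : ∀ (Y : 𝒜) (j : J ⟶ Y) (q : Y ⟶ M), IsSES j q →
      SESSplits j q ∨
        ∃ c : ℂ, c ≠ 0 ∧ ∃ ψ : Y ⟶ H, j ≫ ψ = iH ∧ ψ ≫ pH = q ≫ (c • 𝟙 M))
    (hExtJM : ∀ (Y : 𝒜) (j : M ⟶ Y) (q : Y ⟶ J), IsSES j q →
      SESSplits j q ∨
        ∃ c : ℂ, c ≠ 0 ∧ ∃ ψ : Y ⟶ D, j ≫ ψ = iD ∧ ψ ≫ pD = q ≫ (c • 𝟙 J))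
    (hExtHM : ∀ (X : 𝒜) (a : M ⟶ X) (b : X ⟶ H), IsSES a b → SESSplits a b)
    (hExtMH : ∀ (X : 𝒜) (a : H ⟶ X) (b : X ⟶ M), IsSES a b → SESSplits a b)
    (hExtHJ : ∀ (X : 𝒜) (a : J ⟶ X) (b : X ⟶ H), IsSES a b → SESSplits a b)
    (hExtJH : ∀ (X : 𝒜) (a : H ⟶ X) (b : X ⟶ J), IsSES a b → SESSplits a b) :
    ∀ X : 𝒜, Indecomposable X →
      Nonempty (X ≅ M) ∨ Nonempty (X ≅ J) ∨ Nonempty (X ≅ H) ∨ Nonempty (X ≅ D) := by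
  intro X hX
  have hH0 : ¬ IsZero H := fun h ↦ Simple.not_isZero J (have := hH.mono_s14; h.of_mono iH)
  have hD0 : ¬ IsZero D := fun h ↦ Simple.not_isZero M (have := hD.mono_s14; h.of_mono iD)
  -- `H` is both injective and projective.
  have hHinj {Q X : 𝒜} (a : H ⟶ X) (b : X ⟶ Q) (h : IsSES a b) : SESSplits a b := by
    refine splits_of_splits_simple (fun _ ↦ True) (fun _ _ _ ↦ trivial)
      (fun _ _ _ _ _ ↦ trivial) (fun {S X} a b hS _ h ↦ ?_) (hlen Q) a b trivial h
    obtain ⟨⟨e⟩⟩ | ⟨⟨e⟩⟩ := hsimples S hS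
    · exact hExtMH _ _ _ (h.iso_right e)
    · exact hExtJH _ _ _ (h.iso_right e)
  have hHproj {K X : 𝒜} (a : K ⟶ X) (b : X ⟶ H) (h : IsSES a b) : SESSplits a b := by
    refine splits_of_simple_splits (fun {S X} a b hS h ↦ ?_) (hlen K) a b h
    obtain ⟨⟨e⟩⟩ | ⟨⟨e⟩⟩ := hsimples S hS
    · exact sesSplits_of_iso_left e hExtHM h
    · exact sesSplits_of_iso_left e hExtHJ h
  -- The class of objects without a subobject isomorphic to `H` is a Serre subcategory.
  let HFree (X : 𝒜) : Prop := ∀ f : H ⟶ X, ¬ Mono f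
  have HFree_sub {X Y : 𝒜} (f : X ⟶ Y) (_ : Mono f) (hY : HFree Y) : HFree X :=
    fun g _ ↦ hY (g ≫ f) inferInstance
  have HFree_quot {S X Y : 𝒜} (f : S ⟶ X) (g : X ⟶ Y) (h : IsSES f g) (hX : HFree X) :
      HFree Y := fun k _ ↦ by
    obtain ⟨t, ht⟩ := h.exists_lift_of_pullback k fun j hj ↦ hHproj _ _ hj
    exact hX t (mono_of_mono_fac ht)
  have hMJ_free {X : 𝒜} (a : J ⟶ X) (b : X ⟶ M) (hX : HFree X) (h : IsSES a b) :
      SESSplits a b := by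
    refine (hExtMJ _ _ _ h).resolve_right fun ⟨c, hc, ψ, hψi, hψp⟩ ↦ ?_
    have := isIso_smul_id hc M
    have := h.isIso_middle hH hψi hψp
    exact hX (inv ψ) inferInstance
  have hJinj {Q X : 𝒜} (a : J ⟶ X) (b : X ⟶ Q) (hX : HFree X) (h : IsSES a b) :
      SESSplits a b := by
    refine splits_of_splits_simple HFree HFree_sub (fun f g _ ↦ HFree_quot f g)
      (fun {S X} a b hS hX h ↦ ?_) (hlen Q) a b hX h
    obtain ⟨⟨e⟩⟩ | ⟨⟨e⟩⟩ := hsimples S hS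
    · exact hMJ_free _ _ hX (h.iso_right e)
    · exact hExtJJ _ _ _ (h.iso_right e)
  have hMD_free {X : 𝒜} (a : D ⟶ X) (b : X ⟶ M) (hX : HFree X) (h : IsSES a b) :
      SESSplits a b := by
    obtain ⟨X', q, i', p', hq, hi', -, hqp⟩ := h.exists_quotient_s14 hD
    obtain ⟨s, hs⟩ := hi'.exists_section (hMJ_free _ _ (HFree_quot _ _ hq hX) hi')
    obtain ⟨t, ht⟩ := hq.exists_lift_of_pullback s fun j hj ↦ hExtMM _ _ _ hj
    exact h.splits_of_section t (by rw [← hqp, reassoc_of% ht, hs])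
  have hDinj {Q X : 𝒜} (a : D ⟶ X) (b : X ⟶ Q) (hX : HFree X) (h : IsSES a b) :
      SESSplits a b := by
    refine splits_of_splits_simple HFree HFree_sub (fun f g _ ↦ HFree_quot f g)
      (fun {S X} a b hS hX h ↦ ?_) (hlen Q) a b hX h
    obtain ⟨⟨e⟩⟩ | ⟨⟨e⟩⟩ := hsimples S hS
    · exact hMD_free _ _ hX (h.iso_right e)
    · exact splits_of_spanning_extension_left hD hExtJJ hExtJM (h.iso_right e)
  -- Objects with no subobject isomorphic to `J` or `D` are sums of copies of `M`.
  let JDFree (X : 𝒜) : Prop := (∀ f : J ⟶ X, ¬ Mono f) ∧ ∀ f : D ⟶ X, ¬ Mono f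
  have JDFree_sub {X Y : 𝒜} (f : X ⟶ Y) (_ : Mono f) (hY : JDFree Y) : JDFree X :=
    ⟨fun g _ ↦ hY.1 (g ≫ f) inferInstance, fun g _ ↦ hY.2 (g ≫ f) inferInstance⟩
  have hJM_free {X : 𝒜} (a : M ⟶ X) (b : X ⟶ J) (hX : JDFree X) (h : IsSES a b) :
      SESSplits a b := by
    refine (hExtJM _ _ _ h).resolve_right fun ⟨c, hc, ψ, hψi, hψp⟩ ↦ ?_
    have := isIso_smul_id hc J
    have := h.isIso_middle hD hψi hψp
    exact hX.2 (inv ψ) inferInstance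
  have JDFree_quot {S X Y : 𝒜} (f : S ⟶ X) (g : X ⟶ Y) (hS : Simple S) (h : IsSES f g)
      (hX : JDFree X) : JDFree Y := by
    have := h.mono_s14
    obtain ⟨⟨e⟩⟩ | ⟨⟨e⟩⟩ := hsimples S hS
    · have h' := h.iso_left e.symm
      constructor <;> intro k _
      · obtain ⟨t, ht⟩ := h'.exists_lift_of_pullback k fun j hj ↦
          hJM_free _ _ (JDFree_sub (pullback.fst g k) inferInstance hX) hj
        exact hX.1 t (mono_of_mono_fac ht)
      · obtain ⟨t, ht⟩ := h'.exists_lift_of_pullback k fun j hj ↦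
          splits_of_spanning_extension_right hD hExtMM hExtJM hj
        exact hX.2 t (mono_of_mono_fac ht)
    · exact (hX.1 (e.inv ≫ f) inferInstance).elim
  have hMinj {Q X : 𝒜} (a : M ⟶ X) (b : X ⟶ Q) (hX : JDFree X) (h : IsSES a b) :
      SESSplits a b := by
    refine splits_of_splits_simple JDFree JDFree_sub JDFree_quot
      (fun {S X} a b hS hX h ↦ ?_) (hlen Q) a b hX h
    obtain ⟨⟨e⟩⟩ | ⟨⟨e⟩⟩ := hsimples S hS
    · exact hExtMM _ _ _ (h.iso_right e)
    · exact hJM_free _ _ hX (h.iso_right e)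
  by_cases hXH : HFree X
  · by_cases hXJD : JDFree X
    · obtain ⟨S, f, hS, _⟩ := exists_simple_subobject (hlen X) hX.1
      obtain ⟨⟨e⟩⟩ | ⟨⟨e⟩⟩ := hsimples S hS
      · obtain ⟨r, hr⟩ := hMinj _ _ hXJD (IsSES.of_mono (e.inv ≫ f))
        exact .inl (hX.nonempty_iso_of_retract (Simple.not_isZero M) _ r hr)
      · exact (hXJD.1 (e.inv ≫ f) inferInstance).elim
    · simp only [JDFree, not_and_or, not_forall, not_not] at hXJD
      obtain ⟨f, _⟩ | ⟨f, _⟩ := hXJD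
      · obtain ⟨r, hr⟩ := hJinj _ _ hXH (IsSES.of_mono f)
        exact .inr (.inl (hX.nonempty_iso_of_retract (Simple.not_isZero J) _ r hr))
      · obtain ⟨r, hr⟩ := hDinj _ _ hXH (IsSES.of_mono f)
        exact .inr (.inr (.inr (hX.nonempty_iso_of_retract hD0 _ r hr)))
  · simp only [HFree, not_forall, not_not] at hXH
    obtain ⟨f, _⟩ := hXH
    obtain ⟨r, hr⟩ := hHinj _ _ (IsSES.of_mono f)
    exact .inr (.inr (.inl (hX.nonempty_iso_of_retract hH0 _ r hr)))
end
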